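/- arXiv:2510.20404 — 3 statements merged into one kernel-verified Lean document; each statement's English description precedes it below -/
import Mathlib

section
/- (Weighted-average representation of the AIV estimand) Under consistency Y = Y(A) with binary A, latent ignorability Y(a) ⊥ (A,Z) | (U,L), and Z ⊥ U | L, for any bounded π(Z,L) with Cov(A, π(Z,L)|L) ≠ 0 a.s.: E[ Cov(Y, π(Z,L)|L) / Cov(A, π(Z,L)|L) ] = E[ E[Y(1)−Y(0) | U,L] · Cov(A, π(Z,L) | U,L) / Cov(A, π(Z,L) | L) ]. In particular no AIV condition is needed for this identity. -/
open MeasureTheory ProbabilityTheory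

/-- The σ-algebra generated by a random variable. -/
abbrev mV {Ω β : Type*} [MeasurableSpace β] (X : Ω → β) : MeasurableSpace Ω :=
  MeasurableSpace.comap X inferInstance

/-- Conditional covariance given a sub-σ-algebra `m`:
`Cov(X, Y | m) = E[XY | m] - E[X | m] * E[Y | m]`. -/
noncomputable def condCov {Ω : Type*} [MeasurableSpace Ω] (μ : Measure Ω)
    (m : MeasurableSpace Ω) (X Y : Ω → ℝ) : Ω → ℝ :=
  μ[X * Y | m] - μ[X | m] * μ[Y | m]

lemma aux_const {Ω : Type*} {m : MeasurableSpace Ω} [mΩ : MeasurableSpace Ω] [StandardBorelSpace Ω]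
    (μ : Measure Ω) [IsProbabilityMeasure μ] (hm : m ≤ mΩ) (V : Ω → ℝ)
    (hV : Measurable[m] V) :
    ∀ᵐ ω ∂μ, ∀ᵐ ω' ∂(condExpKernel μ m ω), V ω' = V ω := by
  have hVm : Measurable[mΩ] V := hV.mono hm le_rfl
  have h1 : @Measurable (Ω × Ω) ℝ (m.prod mΩ) _ (fun p => V p.1) :=
    hV.comp measurable_fst
  have h2 : @Measurable (Ω × Ω) ℝ (m.prod mΩ) _ (fun p => V p.2) :=
    hVm.comp measurable_snd
  have hs : @MeasurableSet (Ω × Ω) (m.prod mΩ) {p | V p.2 = V p.1} :=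
    measurableSet_eq_fun h2 h1
  have hd : @Measurable Ω (Ω × Ω) mΩ (m.prod mΩ) Function.diag :=
    (measurable_id'' hm).prodMk measurable_id
  have h := compProd_trim_condExpKernel (μ := μ) hm
  have hae : ∀ᵐ p ∂((μ.trim hm) ⊗ₘ condExpKernel μ m), V p.2 = V p.1 := by
    rw [h, @ae_map_iff Ω (Ω × Ω) mΩ (m.prod mΩ) μ _ (@Measurable.aemeasurable Ω (Ω × Ω) mΩ (m.prod mΩ) _ μ hd) _ hs]
    exact Filter.Eventually.of_forall fun ω => rfl
  exact ae_of_ae_trim hm (Measure.ae_ae_of_ae_compProd hae)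

lemma aux_indep {Ω β γ : Type*} {m : MeasurableSpace Ω} [mΩ : MeasurableSpace Ω]
    [StandardBorelSpace Ω] [MeasurableSpace β] [MeasurableSpace γ]
    [MeasurableSpace.CountablyGenerated (β × γ)]
    (μ : Measure Ω) [IsProbabilityMeasure μ] (hm : m ≤ mΩ) (X : Ω → β) (W : Ω → γ)
    (hX : Measurable X) (hW : Measurable W) (h : CondIndepFun m hm X W μ) :
    ∀ᵐ ω ∂μ, IndepFun X W (condExpKernel μ m ω) := by
  rw [condIndepFun_iff_map_prod_eq_prod_map_map hX hW] at h
  filter_upwards [ae_of_ae_trim hm h] with ω hω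
  rw [indepFun_iff_map_prod_eq_prod_map_map hX.aemeasurable hW.aemeasurable]
  rw [Kernel.map_apply _ (hX.prodMk hW), Kernel.prod_apply, Kernel.map_apply _ hX,
    Kernel.map_apply _ hW] at hω
  exact hω

lemma aux_mul {Ω β γ : Type*} {m : MeasurableSpace Ω} [mΩ : MeasurableSpace Ω]
    [StandardBorelSpace Ω] [MeasurableSpace β] [MeasurableSpace γ]
    [MeasurableSpace.CountablyGenerated (β × γ)]
    (μ : Measure Ω) [IsProbabilityMeasure μ] (hm : m ≤ mΩ) (X : Ω → β) (W : Ω → γ)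
    (hX : Measurable X) (hW : Measurable W) (h : CondIndepFun m hm X W μ)
    (V : Ω → ℝ) (hV : Measurable[m] V)
    (f : β × ℝ → ℝ) (g : γ × ℝ → ℝ) (hf : Measurable f) (hg : Measurable g)
    (hfi : Integrable (fun ω => f (X ω, V ω)) μ)
    (hgi : Integrable (fun ω => g (W ω, V ω)) μ)
    (hfgi : Integrable (fun ω => f (X ω, V ω) * g (W ω, V ω)) μ) :
    μ[fun ω => f (X ω, V ω) * g (W ω, V ω) | m] =ᵐ[μ]
      fun ω => (μ[fun ω => f (X ω, V ω) | m]) ω * (μ[fun ω => g (W ω, V ω) | m]) ω := by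
  have hVm : Measurable[mΩ] V := hV.mono hm le_rfl
  filter_upwards [aux_indep μ hm X W hX hW h, aux_const μ hm V hV,
    condExp_ae_eq_integral_condExpKernel hm hfi, condExp_ae_eq_integral_condExpKernel hm hgi,
    condExp_ae_eq_integral_condExpKernel hm hfgi] with ω hi hc h1 h2 h3
  rw [h1, h2, h3]
  have hi2 : IndepFun (fun ω' => f (X ω', V ω)) (fun ω' => g (W ω', V ω))
      (condExpKernel μ m ω) :=
    hi.comp (φ := fun x => f (x, V ω)) (ψ := fun x => g (x, V ω))
      (by fun_prop) (by fun_prop)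
  have hi3 : IndepFun (fun ω' => f (X ω', V ω')) (fun ω' => g (W ω', V ω'))
      (condExpKernel μ m ω) := by
    refine hi2.congr ?_ ?_ <;> filter_upwards [hc] with ω' h' <;> rw [h']
  exact hi3.integral_fun_mul_eq_mul_integral
    (by exact Measurable.aestronglyMeasurable (by fun_prop))
    (by exact Measurable.aestronglyMeasurable (by fun_prop))

/-- `Z ⊥ U | L` gives `E[f(Z,L) | U,L] = E[f(Z,L) | L]`. -/
lemma aux_drop {Ω : Type*} [mΩ : MeasurableSpace Ω] [StandardBorelSpace Ω]
    (μ : Measure Ω) [IsProbabilityMeasure μ] (Z U L : Ω → ℝ)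
    (hZ : Measurable Z) (hU : Measurable U) (hL : Measurable L)
    (hZU : CondIndepFun (mV L) (measurable_iff_comap_le.mp hL) Z U μ)
    (f : ℝ × ℝ → ℝ) (hf : Measurable f) (C : ℝ) (hC : ∀ p, |f p| ≤ C) :
    μ[fun ω => f (Z ω, L ω) | mV L] =ᵐ[μ] μ[fun ω => f (Z ω, L ω) | mV U ⊔ mV L] := by
  have hmL : mV L ≤ mΩ := measurable_iff_comap_le.mp hL
  have hG : mV U ⊔ mV L ≤ mΩ := sup_le (measurable_iff_comap_le.mp hU) hmL
  have hP : Measurable (fun ω => f (Z ω, L ω)) := by fun_prop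
  have hPi : Integrable (fun ω => f (Z ω, L ω)) μ :=
    Integrable.of_bound hP.aestronglyMeasurable C (Filter.Eventually.of_forall fun ω => hC _)
  refine ae_eq_condExp_of_forall_setIntegral_eq hG hPi
    (fun s _ _ => integrable_condExp.integrableOn) ?_
    (StronglyMeasurable.aestronglyMeasurable
      (StronglyMeasurable.mono (m' := mV L) stronglyMeasurable_condExp le_sup_right))
  intro s hs _
  have hsm : MeasurableSet s := hG s hs
  have hcom : mV U ⊔ mV L = MeasurableSpace.comap (fun ω => (U ω, L ω)) inferInstance :=
    (MeasurableSpace.comap_prodMk U L).symm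
  rw [hcom] at hs
  obtain ⟨t, ht, rfl⟩ := hs
  set g : ℝ × ℝ → ℝ := t.indicator 1 with hgdef
  have hg : Measurable g := measurable_one.indicator ht
  have hgb : ∀ p, |g p| ≤ 1 := fun p => by
    by_cases hp : p ∈ t <;> simp [hgdef, hp]
  have hgi : Integrable (fun ω => g (U ω, L ω)) μ :=
    Integrable.of_bound (Measurable.aestronglyMeasurable (by fun_prop)) 1
      (Filter.Eventually.of_forall fun ω => hgb _)
  have hgm : AEStronglyMeasurable (fun ω => g (U ω, L ω)) μ := hgi.1
  have hgbb : ∀ᵐ ω ∂μ, ‖g (U ω, L ω)‖ ≤ 1 := Filter.Eventually.of_forall fun ω => hgb _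
  have hset : ∀ F : Ω → ℝ, ∫ ω in (fun ω => (U ω, L ω)) ⁻¹' t, F ω ∂μ
      = ∫ ω, F ω * g (U ω, L ω) ∂μ := by
    intro F
    rw [← integral_indicator hsm]
    congr 1; ext ω
    by_cases hp : (U ω, L ω) ∈ t <;> simp [hgdef, hp, Set.indicator]
  rw [hset, hset]
  have key := aux_mul μ hmL Z U hZ hU hZU L (comap_measurable L) f g hf hg hPi hgi
    (hPi.mul_bdd hgm hgbb)
  have pull := condExp_mul_of_stronglyMeasurable_left
    (f := μ[fun ω => f (Z ω, L ω) | mV L]) (g := fun ω => g (U ω, L ω)) (m := mV L) (μ := μ)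
    stronglyMeasurable_condExp (integrable_condExp.mul_bdd hgm hgbb) hgi
  calc ∫ ω, (μ[fun ω => f (Z ω, L ω) | mV L]) ω * g (U ω, L ω) ∂μ
      = ∫ ω, (μ[μ[fun ω => f (Z ω, L ω) | mV L] * (fun ω => g (U ω, L ω)) | mV L]) ω ∂μ :=
        (integral_condExp hmL).symm
    _ = ∫ ω, (μ[fun ω => f (Z ω, L ω) * g (U ω, L ω) | mV L]) ω ∂μ :=
        integral_congr_ae (pull.trans key.symm)
    _ = _ := integral_condExp hmL

/-- (Weighted-average representation of the AIV estimand.) With binary `A`,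
consistency `Y = A·Y(1) + (1−A)·Y(0)`, latent ignorability, and `Z ⊥ U | L`, for any bounded
`π(Z,L)` with `Cov(A, π(Z,L)|L) ≠ 0` a.s.:
`E[Cov(Y,π|L)/Cov(A,π|L)] = E[E[Y(1)−Y(0)|U,L]·Cov(A,π|U,L)/Cov(A,π|L)]`,
with no AIV condition needed. -/
theorem stmt9 {Ω : Type*} [mΩ : MeasurableSpace Ω] [StandardBorelSpace Ω]
    (μ : Measure Ω) [IsProbabilityMeasure μ]
    (A Z U L Y0 Y1 : Ω → ℝ)
    (hA : Measurable A) (hZ : Measurable Z) (hU : Measurable U) (hL : Measurable L)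
    (hY0 : Measurable Y0) (hY1 : Measurable Y1)
    (hA01 : ∀ ω, A ω = 0 ∨ A ω = 1)
    (Y : Ω → ℝ) (hY : Y = fun ω => A ω * Y1 ω + (1 - A ω) * Y0 ω)
    -- latent ignorability: `Y(a) ⊥ (A,Z) | (U,L)` for `a = 0, 1`
    (hLI0 : CondIndepFun (mV U ⊔ mV L)
      (sup_le (measurable_iff_comap_le.mp hU) (measurable_iff_comap_le.mp hL))
      Y0 (fun ω => (A ω, Z ω)) μ)
    (hLI1 : CondIndepFun (mV U ⊔ mV L)
      (sup_le (measurable_iff_comap_le.mp hU) (measurable_iff_comap_le.mp hL))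
      Y1 (fun ω => (A ω, Z ω)) μ)
    -- IV independence: `Z ⊥ U | L`
    (hZU : CondIndepFun (mV L) (measurable_iff_comap_le.mp hL) Z U μ)
    (π : ℝ → ℝ → ℝ) (hπ : Measurable fun p : ℝ × ℝ => π p.1 p.2)
    (Cπ : ℝ) (hπbd : ∀ z l, |π z l| ≤ Cπ)
    (hcov : ∀ᵐ ω ∂μ,
      condCov μ (mV L) A (fun ω' => π (Z ω') (L ω')) ω ≠ 0)
    -- integrability
    (hintY0 : Integrable Y0 μ) (hintY1 : Integrable Y1 μ)
    (hintlhs : Integrable (fun ω =>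
      condCov μ (mV L) Y (fun ω' => π (Z ω') (L ω')) ω /
        condCov μ (mV L) A (fun ω' => π (Z ω') (L ω')) ω) μ)
    (hintrhs : Integrable (fun ω =>
      (μ[fun ω' => Y1 ω' - Y0 ω' | mV U ⊔ mV L]) ω *
        condCov μ (mV U ⊔ mV L) A (fun ω' => π (Z ω') (L ω')) ω /
          condCov μ (mV L) A (fun ω' => π (Z ω') (L ω')) ω) μ) :
    ∫ ω, condCov μ (mV L) Y (fun ω' => π (Z ω') (L ω')) ω /
          condCov μ (mV L) A (fun ω' => π (Z ω') (L ω')) ω ∂μ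
      = ∫ ω, (μ[fun ω' => Y1 ω' - Y0 ω' | mV U ⊔ mV L]) ω *
            condCov μ (mV U ⊔ mV L) A (fun ω' => π (Z ω') (L ω')) ω /
              condCov μ (mV L) A (fun ω' => π (Z ω') (L ω')) ω ∂μ := by
  classical
  have hmL : mV L ≤ mΩ := measurable_iff_comap_le.mp hL
  have hG : mV U ⊔ mV L ≤ mΩ := sup_le (measurable_iff_comap_le.mp hU) hmL
  have hLG : Measurable[mV U ⊔ mV L] L := (comap_measurable L).mono le_sup_right le_rfl
  have hLL : mV L ≤ mV U ⊔ mV L := le_sup_right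
  set P : Ω → ℝ := fun ω' => π (Z ω') (L ω') with hPdef
  have hP : Measurable P := hπ.comp (hZ.prodMk hL)
  have hPb : ∀ᵐ ω ∂μ, ‖P ω‖ ≤ Cπ := Filter.Eventually.of_forall fun ω => hπbd _ _
  have hPi : Integrable P μ := Integrable.of_bound hP.aestronglyMeasurable Cπ hPb
  have hAb : ∀ ω, |A ω| ≤ 1 := fun ω => by rcases hA01 ω with h | h <;> simp [h]
  have hAi : Integrable A μ := Integrable.of_bound hA.aestronglyMeasurable 1
    (Filter.Eventually.of_forall hAb)
  have hAPi : Integrable (fun ω => A ω * P ω) μ := hAi.mul_bdd hP.aestronglyMeasurable hPb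
  have hAPb : ∀ᵐ ω ∂μ, ‖A ω * P ω‖ ≤ 1 * Cπ := by
    filter_upwards [hPb] with ω h
    rw [norm_mul]
    exact mul_le_mul (hAb ω) h (norm_nonneg _) zero_le_one
  have hAbd : ∀ᵐ ω ∂μ, ‖A ω‖ ≤ 1 := Filter.Eventually.of_forall hAb
  have hAPm := hAPi.1
  -- the product formulas given `(U,L)`
  have gen : ∀ T : Ω → ℝ, Measurable T → Integrable T μ →
      CondIndepFun (mV U ⊔ mV L) hG T (fun ω => (A ω, Z ω)) μ →
      (μ[fun ω => T ω * A ω | mV U ⊔ mV L] =ᵐ[μ]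
        fun ω => (μ[T | mV U ⊔ mV L]) ω * (μ[A | mV U ⊔ mV L]) ω) ∧
      (μ[fun ω => T ω * P ω | mV U ⊔ mV L] =ᵐ[μ]
        fun ω => (μ[T | mV U ⊔ mV L]) ω * (μ[P | mV U ⊔ mV L]) ω) ∧
      (μ[fun ω => T ω * (A ω * P ω) | mV U ⊔ mV L] =ᵐ[μ]
        fun ω => (μ[T | mV U ⊔ mV L]) ω * (μ[fun ω => A ω * P ω | mV U ⊔ mV L]) ω) := by
    intro T hT hTi hI
    have hπ' : Measurable (fun q : (ℝ × ℝ) × ℝ => π q.1.2 q.2) :=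
      hπ.comp (measurable_fst.snd.prodMk measurable_snd)
    refine ⟨?_, ?_, ?_⟩
    · exact aux_mul μ hG T (fun ω => (A ω, Z ω)) hT (hA.prodMk hZ) hI L hLG
        (fun q => q.1) (fun q => q.1.1) (by fun_prop) (by fun_prop) hTi hAi
        (hTi.mul_bdd hA.aestronglyMeasurable hAbd)
    · exact aux_mul μ hG T (fun ω => (A ω, Z ω)) hT (hA.prodMk hZ) hI L hLG
        (fun q => q.1) (fun q => π q.1.2 q.2) (by fun_prop) hπ' hTi hPi
        (hTi.mul_bdd hP.aestronglyMeasurable hPb)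
    · exact aux_mul μ hG T (fun ω => (A ω, Z ω)) hT (hA.prodMk hZ) hI L hLG
        (fun q => q.1) (fun q => q.1.1 * π q.1.2 q.2) (by fun_prop)
        ((by fun_prop : Measurable fun q : (ℝ × ℝ) × ℝ => q.1.1).mul hπ') hTi hAPi
        (hTi.mul_bdd hAPm hAPb)
  obtain ⟨h0A, h0P, h0AP⟩ := gen Y0 hY0 hintY0 hLI0
  obtain ⟨h1A, h1P, h1AP⟩ := gen Y1 hY1 hintY1 hLI1
  have i1A := hintY1.mul_bdd hA.aestronglyMeasurable hAbd
  have i0A := hintY0.mul_bdd hA.aestronglyMeasurable hAbd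
  have i1AP := hintY1.mul_bdd hAPm hAPb
  have i0AP := hintY0.mul_bdd hAPm hAPb
  have i0P := hintY0.mul_bdd hP.aestronglyMeasurable hPb
  have eY : Y = ((fun ω => Y1 ω * A ω) - (fun ω => Y0 ω * A ω)) + Y0 := by
    rw [hY]; ext ω; simp only [Pi.add_apply, Pi.sub_apply]; ring
  have eYP : Y * P = ((fun ω => Y1 ω * (A ω * P ω)) - (fun ω => Y0 ω * (A ω * P ω)))
      + (fun ω => Y0 ω * P ω) := by
    rw [hY]; ext ω; simp only [Pi.add_apply, Pi.sub_apply, Pi.mul_apply]; ring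
  have hYi : Integrable Y μ := by rw [eY]; exact (i1A.sub i0A).add hintY0
  have hYPi : Integrable (Y * P) μ := by rw [eYP]; exact (i1AP.sub i0AP).add i0P
  have cY : μ[Y | mV U ⊔ mV L] =ᵐ[μ] fun ω =>
      (μ[fun ω' => Y1 ω' - Y0 ω' | mV U ⊔ mV L]) ω * (μ[A | mV U ⊔ mV L]) ω
        + (μ[Y0 | mV U ⊔ mV L]) ω := by
    rw [eY]
    filter_upwards [condExp_add (i1A.sub i0A) hintY0 (mV U ⊔ mV L),
      condExp_sub i1A i0A (mV U ⊔ mV L), condExp_sub hintY1 hintY0 (mV U ⊔ mV L),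
      h0A, h1A] with ω a1 a2 a3 a4 a5
    have a3' : (μ[fun ω' => Y1 ω' - Y0 ω' | mV U ⊔ mV L]) ω = _ := a3
    rw [a1, Pi.add_apply, a2, Pi.sub_apply, a4, a5, a3', Pi.sub_apply]
    ring
  have cYP : μ[Y * P | mV U ⊔ mV L] =ᵐ[μ] fun ω =>
      (μ[fun ω' => Y1 ω' - Y0 ω' | mV U ⊔ mV L]) ω * (μ[A * P | mV U ⊔ mV L]) ω
        + (μ[Y0 | mV U ⊔ mV L]) ω * (μ[P | mV U ⊔ mV L]) ω := by
    rw [eYP]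
    filter_upwards [condExp_add (i1AP.sub i0AP) i0P (mV U ⊔ mV L),
      condExp_sub i1AP i0AP (mV U ⊔ mV L), condExp_sub hintY1 hintY0 (mV U ⊔ mV L),
      h0AP, h1AP, h0P] with ω a1 a2 a3 a4 a5 a6
    have a3' : (μ[fun ω' => Y1 ω' - Y0 ω' | mV U ⊔ mV L]) ω = _ := a3
    have e : (A * P) = fun ω => A ω * P ω := rfl
    rw [a1, Pi.add_apply, a2, Pi.sub_apply, a4, a5, a3', Pi.sub_apply, a6, e]
    ring
  have hdrop : μ[P | mV L] =ᵐ[μ] μ[P | mV U ⊔ mV L] :=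
    aux_drop μ Z U L hZ hU hL hZU (fun p => π p.1 p.2) hπ Cπ (fun p => hπbd _ _)
  -- the numerator
  set N : Ω → ℝ := fun ω => (μ[fun ω' => Y1 ω' - Y0 ω' | mV U ⊔ mV L]) ω *
        condCov μ (mV U ⊔ mV L) A P ω with hN
  have hN1 : N =ᵐ[μ] μ[Y * P | mV U ⊔ mV L] - μ[Y | mV U ⊔ mV L] * μ[P | mV L] := by
    filter_upwards [cY, cYP, hdrop] with ω a1 a2 a3
    simp only [hN, condCov, Pi.sub_apply, Pi.mul_apply]
    rw [a1, a2, a3]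
    ring
  have hPLb : ∀ᵐ ω ∂μ, ‖(μ[P | mV L]) ω‖ ≤ Cπ := by
    exact ae_bdd_abs_condExp_of_ae_bdd_abs (m := mV L) (R := Cπ) (f := P) (μ := μ) hPb
  have hPLm : AEStronglyMeasurable (μ[P | mV L]) μ := integrable_condExp.1
  have iYGP : Integrable (μ[Y | mV U ⊔ mV L] * μ[P | mV L]) μ :=
    integrable_condExp.mul_bdd hPLm hPLb
  have iYP : Integrable (Y * μ[P | mV L]) μ := hYi.mul_bdd hPLm hPLb
  have hNi : Integrable N μ := (integrable_congr hN1).mpr (integrable_condExp.sub iYGP)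
  have hN2 : μ[N | mV L] =ᵐ[μ] condCov μ (mV L) Y P := by
    refine (condExp_congr_ae hN1).trans ?_
    filter_upwards [condExp_sub (integrable_condExp (f := Y * P) (m := mV U ⊔ mV L)) iYGP (mV L),
      condExp_condExp_of_le (μ := μ) (f := Y * P) hLL hG,
      condExp_condExp_of_le (μ := μ) (f := Y) hLL hG,
      condExp_mul_of_stronglyMeasurable_right (m := mV L) (g := μ[P | mV L])
        stronglyMeasurable_condExp iYGP integrable_condExp] with ω a1 a2 a3 a4
    rw [a1, Pi.sub_apply, a2, a4, Pi.mul_apply, a3]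
    rfl
  have hDm : StronglyMeasurable[mV L] (condCov μ (mV L) A P) :=
    stronglyMeasurable_condExp.sub (stronglyMeasurable_condExp.mul stronglyMeasurable_condExp)
  have hDinv : StronglyMeasurable[mV L] (fun ω => (condCov μ (mV L) A P ω)⁻¹) :=
    hDm.measurable.inv.stronglyMeasurable
  have hpull := condExp_mul_of_stronglyMeasurable_right (m := mV L) (f := N)
    (g := fun ω => (condCov μ (mV L) A P ω)⁻¹) hDinv hintrhs hNi
  calc ∫ ω, condCov μ (mV L) Y P ω / condCov μ (mV L) A P ω ∂μ
      = ∫ ω, (μ[N * (fun ω => (condCov μ (mV L) A P ω)⁻¹) | mV L]) ω ∂μ := by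
        refine integral_congr_ae ?_
        filter_upwards [hpull, hN2] with ω a1 a2
        rw [a1, Pi.mul_apply, a2, div_eq_mul_inv]
    _ = ∫ ω, (N * (fun ω => (condCov μ (mV L) A P ω)⁻¹)) ω ∂μ := integral_condExp hmL
    _ = _ := rfl
end

section
/- (MIV identification) Assume consistency Y = Y(a) on {A=a}, latent ignorability Y(a) ⊥ (A,Z)|(U,L), Z ⊥ U|L, IV relevance, and the multiplicative IV condition P(A ≠ a | Z,U,L) = b(U,L)·c(Z,L) with c nonconstant in Z given each L. If f° solves E[1{A=a}Y | Z,L] = E[f°(1{A=a}, L) | Z,L], then f°(1,L) = E[Y(a) | L] and f°(0,L) = E[Y(a)|L] − E[Y(a) | L, A ≠ a]. Consequently, writing A⁽ᵃ⁾ = 1{A=a}, E[Y(a)] = E[ (1−A⁽ᵃ⁾)·Cov(A⁽ᵃ⁾Y, π(Z,L)|L)/Cov(A⁽ᵃ⁾, π(Z,L)|L) + A⁽ᵃ⁾Y ] for any RWF π. -/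
open MeasureTheory ProbabilityTheory

lemma aux_ci {Ω β β' γ : Type*} [mΩ : MeasurableSpace Ω] [StandardBorelSpace Ω]
    {μ : Measure Ω} [IsProbabilityMeasure μ]
    [MeasurableSpace β] [MeasurableSpace β'] [MeasurableSpace γ]
    [StandardBorelSpace β] [Nonempty β] [StandardBorelSpace β'] [Nonempty β']
    {f : Ω → β} {g : Ω → β'} {k : Ω → γ}
    (hf : Measurable f) (hg : Measurable g) (hk : Measurable k)
    {m : MeasurableSpace Ω} (hm : m ≤ mΩ) (hmk : m = mV k)
    (h : CondIndepFun m hm g f μ) {F : Ω → ℝ} (hF : StronglyMeasurable[mV f ⊔ m] F)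
    (hFi : Integrable F μ) :
    μ[F | mV g ⊔ m] =ᵐ[μ] μ[F | m] := by
  subst hmk
  have e1 : mV f ⊔ mV k = MeasurableSpace.comap (fun ω => (k ω, f ω)) inferInstance := by
    rw [sup_comm]; exact (MeasurableSpace.comap_prodMk k f).symm
  have e2 : mV g ⊔ mV k = MeasurableSpace.comap (fun ω => (k ω, g ω)) inferInstance := by
    rw [sup_comm]; exact (MeasurableSpace.comap_prodMk k g).symm
  rw [e1] at hF
  obtain ⟨G, hG, rfl⟩ := hF.exists_eq_measurable_comp
  have h' := (condIndepFun_iff_condDistrib_prod_ae_eq_prodMkRight hf hg hk).1 h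
  have h'' := ae_of_ae_map (by fun_prop) h'
  rw [e2]
  have t1 := condExp_prod_ae_eq_integral_condDistrib (μ := μ) hk hf.aemeasurable hG hFi
  have t2 := condExp_prod_ae_eq_integral_condDistrib (μ := μ) (X := fun ω => (k ω, g ω))
    (hk.prodMk hg) hf.aemeasurable
    (f := fun p : (γ × β') × β => G (p.1.1, p.2))
    (hG.comp_measurable (by fun_prop)) hFi
  refine Filter.EventuallyEq.trans t2 (Filter.EventuallyEq.trans ?_ t1.symm)
  filter_upwards [h''] with ω hω
  simp only [hω, Kernel.prodMkRight_apply]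

lemma aux_pull {Ω : Type*} [mΩ : MeasurableSpace Ω] {μ : Measure Ω} {m : MeasurableSpace Ω}
    {f g : Ω → ℝ} (hf : StronglyMeasurable[m] f)
    (hfg : Integrable (fun ω => f ω * g ω) μ) (hg : Integrable g μ) :
    μ[fun ω => f ω * g ω | m] =ᵐ[μ] fun ω => f ω * (μ[g | m]) ω :=
  condExp_mul_of_stronglyMeasurable_left hf hfg hg

lemma aux_bmul {Ω : Type*} [mΩ : MeasurableSpace Ω] {μ : Measure Ω}
    {f g : Ω → ℝ} {C : ℝ} (hf : AEStronglyMeasurable f μ) (hb : ∀ᵐ ω ∂μ, |f ω| ≤ C)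
    (hg : Integrable g μ) : Integrable (fun ω => f ω * g ω) μ :=
  hg.bdd_mul hf hb

lemma aux_key {Ω : Type*} {mL mZL mUL mZUL : MeasurableSpace Ω} [mΩ : MeasurableSpace Ω]
    {μ : Measure Ω} [IsProbabilityMeasure μ]
    (h0 : mZUL ≤ mΩ) (hLZ : mL ≤ mZL) (hLU : mL ≤ mUL) (hZ : mZL ≤ mZUL) (hU : mUL ≤ mZUL)
    (hciZ : ∀ F : Ω → ℝ, StronglyMeasurable[mZL] F → Integrable F μ → μ[F | mUL] =ᵐ[μ] μ[F | mL])
    (hciU : ∀ F : Ω → ℝ, StronglyMeasurable[mUL] F → Integrable F μ → μ[F | mZL] =ᵐ[μ] μ[F | mL])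
    {b c W V g : Ω → ℝ} (hb : StronglyMeasurable[mUL] b) (hc : StronglyMeasurable[mZL] c)
    (hg : StronglyMeasurable[mUL] g) (hgi : Integrable g μ)
    (hW : Integrable W μ) (hWb : ∀ ω, |W ω| ≤ 1) (hV : Integrable V μ)
    (hMW : μ[W | mZUL] =ᵐ[μ] fun ω => b ω * c ω)
    (hMV : μ[V | mZUL] =ᵐ[μ] fun ω => b ω * c ω * g ω)
    (hden : ∀ᵐ ω ∂μ, (μ[W | mL]) ω ≠ 0) :
    ∀ᵐ ω ∂μ, (μ[V | mZL]) ω * (μ[W | mL]) ω = (μ[W | mZL]) ω * (μ[V | mL]) ω := by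
  have hL0 : mL ≤ mΩ := hLZ.trans (hZ.trans h0)
  have hZ0 : mZL ≤ mΩ := hZ.trans h0
  have hU0 : mUL ≤ mΩ := hU.trans h0
  set κ : Ω → ℝ := fun ω => min |c ω| 1 with hκ
  have hκm : StronglyMeasurable[mZL] κ :=
    (continuous_abs.min continuous_const).comp_stronglyMeasurable hc
  have hκ0 : ∀ ω, 0 ≤ κ ω := fun ω => le_min (abs_nonneg _) zero_le_one
  have hκ1 : ∀ ω, |κ ω| ≤ 1 := fun ω => by rw [abs_of_nonneg (hκ0 ω)]; exact min_le_right _ _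
  have hκi : Integrable κ μ :=
    Integrable.of_bound (hκm.mono hZ0).aestronglyMeasurable 1 (ae_of_all _ hκ1)
  set k : Ω → ℝ := μ[κ | mL] with hk
  have hkm : StronglyMeasurable[mL] k := stronglyMeasurable_condExp
  have hk1 : ∀ᵐ ω ∂μ, |k ω| ≤ 1 := ae_bdd_abs_condExp_of_ae_bdd_abs (ae_of_all _ hκ1)
  have hbc1 : ∀ᵐ ω ∂μ, |b ω * c ω| ≤ 1 := by
    filter_upwards [hMW, ae_bdd_abs_condExp_of_ae_bdd_abs (m := mZUL) (ae_of_all μ hWb)] with ω h1 h2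
    rwa [h1] at h2
  have hbκ : ∀ᵐ ω ∂μ, |b ω * κ ω| ≤ 1 := by
    filter_upwards [hbc1] with ω h
    rw [abs_mul] at h ⊢
    refine le_trans (mul_le_mul_of_nonneg_left ?_ (abs_nonneg _)) h
    rw [abs_of_nonneg (hκ0 ω)]; exact min_le_left _ _
  have hbk1 : ∀ᵐ ω ∂μ, |b ω * k ω| ≤ 1 := by
    have hi : Integrable (fun ω => b ω * κ ω) μ :=
      Integrable.of_bound ((hb.mono hU0).mul (hκm.mono hZ0)).aestronglyMeasurable 1 hbκ
    filter_upwards [aux_pull hb hi hκi, hciZ κ hκm hκi,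
      ae_bdd_abs_condExp_of_ae_bdd_abs (m := mUL) hbκ] with ω h1 h2 h3
    rw [h1, h2] at h3; exact h3
  have hbkm : StronglyMeasurable[mUL] (fun ω => b ω * k ω) := hb.mul (hkm.mono hLU)
  have hbki : Integrable (fun ω => b ω * k ω) μ :=
    Integrable.of_bound (hbkm.mono hU0).aestronglyMeasurable 1 hbk1
  have hbkgi : Integrable (fun ω => b ω * k ω * g ω) μ :=
    aux_bmul (hbkm.mono hU0).aestronglyMeasurable hbk1 hgi
  -- general step
  have step : ∀ (V g : Ω → ℝ), StronglyMeasurable[mUL] g → Integrable V μ →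
      Integrable (fun ω => b ω * k ω * g ω) μ → 
      (μ[V | mZUL] =ᵐ[μ] fun ω => b ω * c ω * g ω) →
      ∀ᵐ ω ∂μ, k ω * (μ[V | mZL]) ω = c ω * (μ[fun ω => b ω * k ω * g ω | mL]) ω := by
    intro V g hg hV hi hM
    have e1 := hciU (fun ω => b ω * k ω * g ω) (hbkm.mul hg) hi
    have hkV : Integrable (fun ω => k ω * (μ[V | mZUL]) ω) μ :=
      aux_bmul (hkm.mono hL0).aestronglyMeasurable hk1 integrable_condExp
    have eq : (fun ω => k ω * (μ[V | mZUL]) ω) =ᵐ[μ] fun ω => c ω * (b ω * k ω * g ω) := by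
      filter_upwards [hM] with ω h
      rw [h]; ring
    have e2 := aux_pull hc (hkV.congr eq) hi
    have e3 := aux_pull (hkm.mono hLZ) hkV integrable_condExp
    have e4 := condExp_condExp_of_le (μ := μ) (f := V) hZ h0
    have e5 := condExp_congr_ae (m := mZL) eq
    filter_upwards [e1, e2, e3, e4, e5] with ω h1 h2 h3 h4 h5
    rw [h3, h4, h2] at h5
    rw [h5, ← h1]
  have sV := step V g hg hV hbkgi hMV
  have sW := step W (fun _ => 1) stronglyMeasurable_const hW (by simpa using hbki) (by simpa using hMW)
  simp only [mul_one] at sW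
  set β : Ω → ℝ := μ[fun ω => b ω * k ω | mL] with hβ
  set γ : Ω → ℝ := μ[fun ω => b ω * k ω * g ω | mL] with hγ
  have hβ1 : ∀ᵐ ω ∂μ, |β ω| ≤ 1 := ae_bdd_abs_condExp_of_ae_bdd_abs hbk1
  have hβm : StronglyMeasurable[mL] β := stronglyMeasurable_condExp
  have hγm : StronglyMeasurable[mL] γ := stronglyMeasurable_condExp
  have cross : (fun ω => k ω * β ω * (μ[V | mZL]) ω) =ᵐ[μ] fun ω => k ω * γ ω * (μ[W | mZL]) ω := by
    filter_upwards [sV, sW] with ω h1 h2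
    linear_combination β ω * h1 - γ ω * h2
  have hkβ : ∀ᵐ ω ∂μ, |k ω * β ω| ≤ 1 := by
    filter_upwards [hk1, hβ1] with ω h1 h2
    rw [abs_mul]; exact mul_le_one₀ h1 (abs_nonneg _) h2
  have hi1 : Integrable (fun ω => k ω * β ω * (μ[V | mZL]) ω) μ :=
    aux_bmul ((hkm.mul hβm).mono hL0).aestronglyMeasurable hkβ integrable_condExp
  have c1 := aux_pull (hkm.mul hβm) hi1 integrable_condExp
  have c2 := aux_pull (hkm.mul hγm) (hi1.congr cross) integrable_condExp
  have c3 := condExp_congr_ae (m := mL) cross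
  have c4 := condExp_condExp_of_le (μ := μ) (f := V) hLZ hZ0
  have c5 := condExp_condExp_of_le (μ := μ) (f := W) hLZ hZ0
  -- k nonzero
  have hkne : ∀ᵐ ω ∂μ, k ω ≠ 0 := by
    set S : Set Ω := {ω | k ω = 0} with hS
    have hSm : MeasurableSet[mL] S := hkm.measurable (measurableSet_singleton (0 : ℝ))
    have hint : ∫ ω in S, κ ω ∂μ = 0 := by
      rw [← setIntegral_condExp hL0 hκi hSm]
      exact setIntegral_eq_zero_of_forall_eq_zero fun ω hω => hω
    have hz : ∀ᵐ ω ∂(μ.restrict S), κ ω = 0 :=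
      (integral_eq_zero_iff_of_nonneg hκ0 hκi.integrableOn).1 hint
    rw [ae_restrict_iff' (hL0 _ hSm)] at hz
    have hbc0 : (S.indicator (μ[W | mZUL])) =ᵐ[μ] 0 := by
      filter_upwards [hz, hMW] with ω h1 h2
      by_cases hω : ω ∈ S
      · rw [Set.indicator_of_mem hω, h2]
        have h3 := h1 hω
        have : c ω = 0 := by
          simp only [hκ] at h3
          by_contra hne
          have := lt_min (abs_pos.2 hne) one_pos
          linarith
        simp [this]
      · simp [Set.indicator_of_notMem hω]
    have i1 := condExp_indicator (m := mL) (μ := μ) (f := μ[W | mZUL]) integrable_condExp hSm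
    have i2 := condExp_congr_ae (m := mL) hbc0
    have i3 := condExp_condExp_of_le (μ := μ) (f := W) (hLZ.trans hZ) h0
    filter_upwards [i1, i2, i3, hden] with ω h1 h2 h3 h4 h5
    rw [h1, Set.indicator_of_mem (show ω ∈ S from h5), h3] at h2
    simp only [condExp_zero] at h2
    exact h4 h2
  filter_upwards [sV, sW, c1, c2, c3, c4, c5, hkne] with ω h1 h2 h3 h4 h5 h6 h7 h8
  have h9 : k ω * β ω * (μ[V | mL]) ω = k ω * γ ω * (μ[W | mL]) ω := by
    rw [← h6, ← h7]
    exact h3.symm.trans (h5.trans h4)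
  have : k ω * k ω * ((μ[V | mZL]) ω * (μ[W | mL]) ω - (μ[W | mZL]) ω * (μ[V | mL]) ω) = 0 := by
    linear_combination k ω * (μ[W | mL]) ω * h1 - k ω * (μ[V | mL]) ω * h2 - c ω * h9
  have := (mul_eq_zero.1 this).resolve_left (mul_ne_zero h8 h8)
  linarith

lemma aux_tow {Ω : Type*} {mL mZL : MeasurableSpace Ω} [mΩ : MeasurableSpace Ω]
    {μ : Measure Ω} [IsProbabilityMeasure μ] (hLZ : mL ≤ mZL) (hZ0 : mZL ≤ mΩ)
    {P X : Ω → ℝ} {C : ℝ} (hP : StronglyMeasurable[mZL] P) (hPb : ∀ ω, |P ω| ≤ C)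
    (hX : Integrable X μ) :
    μ[X * P | mL] =ᵐ[μ] μ[fun ω => P ω * (μ[X | mZL]) ω | mL] := by
  have hi : Integrable (fun ω => P ω * X ω) μ :=
    aux_bmul (hP.mono hZ0).aestronglyMeasurable (ae_of_all _ hPb) hX
  have e : X * P = fun ω => P ω * X ω := by ext ω; simp [mul_comm]
  rw [e]
  exact (condExp_condExp_of_le hLZ hZ0).symm.trans (condExp_congr_ae (aux_pull hP hi hX))

lemma aux_final {Ω : Type*} {mL mZL : MeasurableSpace Ω} [mΩ : MeasurableSpace Ω]
    {μ : Measure Ω} [IsProbabilityMeasure μ] (hLZ : mL ≤ mZL) (hZ0 : mZL ≤ mΩ)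
    {B Y Ya P f1 f0 : Ω → ℝ} {C : ℝ} (hBm : Measurable B) (hB : ∀ ω, B ω = 0 ∨ B ω = 1)
    (hBY : ∀ ω, B ω * Y ω = B ω * Ya ω) (hYa : Integrable Ya μ)
    (hf1 : StronglyMeasurable[mL] f1) (hf0 : StronglyMeasurable[mL] f0)
    (hP : StronglyMeasurable[mZL] P) (hPb : ∀ ω, |P ω| ≤ C)
    (hi1 : Integrable (fun ω => f1 ω * B ω) μ) (hi0 : Integrable (fun ω => f0 ω * (1 - B ω)) μ)
    (hsol : μ[fun ω => B ω * Y ω | mZL] =ᵐ[μ]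
      μ[fun ω => f1 ω * B ω + f0 ω * (1 - B ω) | mZL])
    (hYaZ : μ[Ya | mZL] =ᵐ[μ] μ[Ya | mL])
    (hkey : ∀ᵐ ω ∂μ, (μ[fun ω => (1 - B ω) * Ya ω | mZL]) ω * (μ[fun ω => 1 - B ω | mL]) ω
      = (μ[fun ω => 1 - B ω | mZL]) ω * (μ[fun ω => (1 - B ω) * Ya ω | mL]) ω)
    (hden : ∀ᵐ ω ∂μ, (μ[fun ω' => 1 - B ω' | mL]) ω ≠ 0)
    (hcov : ∀ᵐ ω ∂μ, condCov μ mL B P ω ≠ 0)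
    (hint : Integrable (fun ω => (1 - B ω) *
      (condCov μ mL (fun ω' => B ω' * Y ω') P ω / condCov μ mL B P ω) + B ω * Y ω) μ) :
    (f1 =ᵐ[μ] μ[Ya | mL])
    ∧ (f0 =ᵐ[μ] fun ω => (μ[Ya | mL]) ω -
            (μ[fun ω' => (1 - B ω') * Ya ω' | mL]) ω / (μ[fun ω' => 1 - B ω' | mL]) ω)
    ∧ (∫ ω, Ya ω ∂μ = ∫ ω, (1 - B ω) *
      (condCov μ mL (fun ω' => B ω' * Y ω') P ω / condCov μ mL B P ω) + B ω * Y ω ∂μ) := by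
  have hL0 : mL ≤ mΩ := hLZ.trans hZ0
  have hBb : ∀ ω, |B ω| ≤ 1 := fun ω => by rcases hB ω with h | h <;> simp [h]
  have hWb : ∀ ω, |1 - B ω| ≤ 1 := fun ω => by rcases hB ω with h | h <;> simp [h]
  have hBi : Integrable B μ := Integrable.of_bound hBm.aestronglyMeasurable 1 (ae_of_all _ hBb)
  have hWm : Measurable (fun ω => 1 - B ω) := measurable_const.sub hBm
  have hWi : Integrable (fun ω => 1 - B ω) μ :=
    Integrable.of_bound hWm.aestronglyMeasurable 1 (ae_of_all _ hWb)
  have hVi : Integrable (fun ω => (1 - B ω) * Ya ω) μ :=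
    aux_bmul hWm.aestronglyMeasurable (ae_of_all _ hWb) hYa
  have hBYi : Integrable (fun ω => B ω * Y ω) μ := by
    simp_rw [hBY]
    exact aux_bmul hBm.aestronglyMeasurable (ae_of_all _ hBb) hYa
  have hBYe : (fun ω => B ω * Y ω) = Ya - fun ω => (1 - B ω) * Ya ω := by
    ext ω; rw [hBY]; simp only [Pi.sub_apply]; ring
  have hBe : B = (fun _ => (1 : ℝ)) - fun ω => 1 - B ω := by
    ext ω; simp
  set W : Ω → ℝ := fun ω => 1 - B ω with hW
  set V : Ω → ℝ := fun ω => (1 - B ω) * Ya ω with hV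
  set p : Ω → ℝ := μ[W | mZL] with hp
  set y : Ω → ℝ := μ[V | mZL] with hy
  set X : Ω → ℝ := μ[W | mL] with hX
  set T : Ω → ℝ := μ[V | mL] with hT
  set h : Ω → ℝ := μ[Ya | mL] with hh
  set R : Ω → ℝ := fun ω => T ω / X ω with hR
  have hXm : StronglyMeasurable[mL] X := stronglyMeasurable_condExp
  have hTm : StronglyMeasurable[mL] T := stronglyMeasurable_condExp
  have hhm : StronglyMeasurable[mL] h := stronglyMeasurable_condExp
  have hRm : StronglyMeasurable[mL] R := (hTm.measurable.div hXm.measurable).stronglyMeasurable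
  have hpi : Integrable p μ := integrable_condExp
  have hyi : Integrable y μ := integrable_condExp
  have hhi : Integrable h μ := integrable_condExp
  have hp1 : ∀ᵐ ω ∂μ, |p ω| ≤ 1 := ae_bdd_abs_condExp_of_ae_bdd_abs (ae_of_all _ hWb)
  have hyR : y =ᵐ[μ] fun ω => R ω * p ω := by
    filter_upwards [hkey, hden] with ω h1 h2
    simp only [hR]
    field_simp
    linarith
  have hBZ : μ[B | mZL] =ᵐ[μ] fun ω => 1 - p ω := by
    have := condExp_sub (μ := μ) (integrable_const (1:ℝ)) hWi mZL
    rw [← hBe] at this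
    refine this.trans ?_
    rw [condExp_const hZ0]; rfl
  have hBL : μ[B | mL] =ᵐ[μ] fun ω => 1 - X ω := by
    have := condExp_sub (μ := μ) (integrable_const (1:ℝ)) hWi mL
    rw [← hBe] at this
    refine this.trans ?_
    rw [condExp_const hL0]; rfl
  have hBYZ : μ[fun ω => B ω * Y ω | mZL] =ᵐ[μ] fun ω => h ω - y ω := by
    rw [hBYe]
    filter_upwards [condExp_sub hYa hVi mZL, hYaZ] with ω h1 h2
    rw [h1, Pi.sub_apply, h2]
  have hBYL : μ[fun ω => B ω * Y ω | mL] =ᵐ[μ] fun ω => h ω - T ω := by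
    rw [hBYe]
    exact condExp_sub hYa hVi mL
  have hPi : Integrable P μ :=
    Integrable.of_bound (hP.mono hZ0).aestronglyMeasurable C (ae_of_all _ hPb)
  have hPae := (hP.mono hZ0).aestronglyMeasurable (μ := μ)
  have hPp : Integrable (fun ω => P ω * p ω) μ := aux_bmul hPae (ae_of_all _ hPb) hpi
  have hPy : Integrable (fun ω => P ω * y ω) μ := aux_bmul hPae (ae_of_all _ hPb) hyi
  have hPh : Integrable (fun ω => P ω * h ω) μ := aux_bmul hPae (ae_of_all _ hPb) hhi
  set q : Ω → ℝ := μ[fun ω => P ω * p ω | mL] with hq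
  set e : Ω → ℝ := μ[P | mL] with he
  have hcB : condCov μ mL B P =ᵐ[μ] fun ω => -(q ω - X ω * e ω) := by
    have t1 := aux_tow hLZ hZ0 hP hPb hBi
    have t2 : (fun ω => P ω * (μ[B | mZL]) ω) =ᵐ[μ] P - fun ω => P ω * p ω := by
      filter_upwards [hBZ] with ω h1
      simp only [h1, Pi.sub_apply]; ring
    filter_upwards [t1, condExp_congr_ae (m := mL) t2, condExp_sub hPi hPp mL, hBL]
      with ω h1 h2 h3 h4
    simp only [condCov, Pi.sub_apply, Pi.mul_apply] at *
    rw [h1, h2, h3, h4]; ring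
  have hcBY : condCov μ mL (fun ω => B ω * Y ω) P =ᵐ[μ] fun ω => -(R ω * (q ω - X ω * e ω)) := by
    have t1 := aux_tow hLZ hZ0 hP hPb hBYi
    have t2 : (fun ω => P ω * (μ[fun ω => B ω * Y ω | mZL]) ω) =ᵐ[μ]
        (fun ω => h ω * P ω) - fun ω => R ω * (P ω * p ω) := by
      filter_upwards [hBYZ, hyR] with ω h1 h2
      simp only [h1, h2, Pi.sub_apply]; ring
    have i1 : Integrable (fun ω => h ω * P ω) μ := by simpa only [mul_comm] using hPh
    have i2 : Integrable (fun ω => R ω * (P ω * p ω)) μ := by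
      refine hPy.congr ?_
      filter_upwards [hyR] with ω h2
      rw [h2]; ring
    filter_upwards [t1, condExp_congr_ae (m := mL) t2, condExp_sub i1 i2 mL, hBYL,
      aux_pull hhm i1 hPi, aux_pull hRm i2 hPp, hden] with ω h1 h2 h3 h4 h5 h6 h7
    simp only [condCov, Pi.sub_apply, Pi.mul_apply] at *
    rw [h1, h2, h3, h4, h5, h6]
    have : T ω = R ω * X ω := by simp only [hR]; field_simp
    rw [this]; ring
  have hratio : ∀ᵐ ω ∂μ, condCov μ mL (fun ω' => B ω' * Y ω') P ω / condCov μ mL B P ω = R ω := by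
    filter_upwards [hcB, hcBY, hcov] with ω h1 h2 h3
    rw [h1] at h3
    rw [h1, h2, div_eq_iff h3]
    ring
  -- the NPIV equation
  have hnp : ∀ᵐ ω ∂μ, f1 ω - h ω = (f1 ω - f0 ω - R ω) * p ω := by
    filter_upwards [hsol, hBYZ, condExp_add hi1 hi0 mZL, aux_pull (hf1.mono hLZ) hi1 hBi,
      aux_pull (hf0.mono hLZ) hi0 hWi, hBZ, hyR] with ω h1 h2 h3 h4 h5 h6 h7
    have h8 : (μ[fun ω => f1 ω * B ω + f0 ω * (1 - B ω) | mZL]) ω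
      = f1 ω * (1 - p ω) + f0 ω * p ω := by
      rw [← h6, ← h4]
      exact h3.trans (congrArg _ h5)
    rw [h2, h8, h7] at h1
    linear_combination -h1
  set E : Ω → ℝ := fun ω => f1 ω - f0 ω - R ω with hE
  have hEm : StronglyMeasurable[mL] E := (hf1.sub hf0).sub hRm
  set K : Ω → ℝ := fun ω => (1 + |E ω|)⁻¹ with hK
  have hKpos : ∀ ω, 0 < K ω := fun ω => by positivity
  have hKm : StronglyMeasurable[mL] K := by
    have : Measurable[mL] E := hEm.measurable
    have h2 : Measurable (fun x : ℝ => (1 + |x|)⁻¹) := by fun_prop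
    exact (h2.comp this).stronglyMeasurable
  set r : Ω → ℝ := fun ω => K ω * E ω with hr
  set s : Ω → ℝ := fun ω => K ω * (f1 ω - h ω) with hs
  have hrm : StronglyMeasurable[mL] r := hKm.mul hEm
  have hsm : StronglyMeasurable[mL] s := hKm.mul (hf1.sub hhm)
  have hr1 : ∀ ω, |r ω| ≤ 1 := fun ω => by
    simp only [hr, hK]
    rw [abs_mul, abs_of_pos (hKpos ω), inv_mul_le_iff₀ (by positivity)]
    linarith
  have hsr : s =ᵐ[μ] fun ω => r ω * p ω := by
    filter_upwards [hnp] with ω h1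
    simp only [hs, hr, h1, hE]; ring
  have hrae := (hrm.mono hL0).aestronglyMeasurable (μ := μ)
  have hrp : Integrable (fun ω => r ω * p ω) μ := aux_bmul hrae (ae_of_all _ hr1) hpi
  have hrPp : Integrable (fun ω => r ω * (P ω * p ω)) μ := aux_bmul hrae (ae_of_all _ hr1) hPp
  have hsi : Integrable s μ := hrp.congr hsr.symm
  have hsr2 : (fun ω => s ω * P ω) =ᵐ[μ] fun ω => r ω * (P ω * p ω) := by
    filter_upwards [hsr] with ω h1
    rw [h1]; ring
  have hsP : Integrable (fun ω => s ω * P ω) μ := hrPp.congr hsr2.symm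
  have hE0 : ∀ᵐ ω ∂μ, E ω = 0 := by
    have a1 := condExp_congr_ae (m := mL) hsr
    rw [condExp_of_stronglyMeasurable hL0 hsm hsi] at a1
    filter_upwards [a1, aux_pull hrm hrp hpi, condExp_congr_ae (m := mL) hsr2,
      aux_pull hrm hrPp hPp, aux_pull hsm hsP hPi, hcB, hcov,
      condExp_condExp_of_le (μ := μ) (f := W) hLZ hZ0] with ω h1 h2 h3 h4 h5 h6 h7 h8
    rw [h6] at h7
    rw [h2, h8] at h1
    rw [h4, h5] at h3
    have h9 : r ω * -(q ω - X ω * e ω) = 0 := by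
      linear_combination -(e ω) * h1 + h3
    have h10 := (mul_eq_zero.1 h9).resolve_right h7
    exact (mul_eq_zero.1 h10).resolve_left (hKpos ω).ne'
  have hF1 : f1 =ᵐ[μ] h := by
    filter_upwards [hE0, hnp] with ω h1 h2
    simp only [hE] at h1
    rw [h1] at h2
    linarith
  refine ⟨hF1, ?_, ?_⟩
  · filter_upwards [hE0, hF1] with ω h1 h2
    simp only [hE, hR] at h1
    linarith
  · have g1 : (fun ω => (1 - B ω) *
      (condCov μ mL (fun ω' => B ω' * Y ω') P ω / condCov μ mL B P ω) + B ω * Y ω) =ᵐ[μ]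
        fun ω => R ω * W ω + B ω * Y ω := by
      filter_upwards [hratio] with ω h1
      rw [h1]; simp only [hW]; ring
    have g2 : Integrable (fun ω => R ω * W ω) μ := by
      have := (hint.congr g1).sub hBYi
      refine this.congr (ae_of_all _ fun ω => ?_)
      simp
    have g3 : ∫ ω, R ω * W ω ∂μ = ∫ ω, V ω ∂μ := by
      rw [← integral_condExp hL0, ← integral_condExp (f := V) hL0]
      refine integral_congr_ae ?_
      filter_upwards [aux_pull hRm g2 hWi, hden] with ω h1 h2
      rw [h1]
      simp only [hR]
      exact div_mul_cancel₀ _ h2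
    rw [integral_congr_ae g1, integral_add g2 hBYi, g3, ← integral_add hVi hBYi]
    refine integral_congr_ae (ae_of_all _ fun ω => ?_)
    simp only [hV, hBY]; ring

/-- (MIV identification.) Under consistency, latent ignorability,
`Z ⊥ U | L`, IV relevance, and the multiplicative IV condition
`P(A ≠ a | Z,U,L) = b(U,L)·c(Z,L)` with `c` nonconstant in `Z`, if `f°` solves the NPIV
equation `E[1{A=a}Y | Z,L] = E[f°(1{A=a},L) | Z,L]`, then `f°(1,L) = E[Y(a)|L]` and
`f°(0,L) = E[Y(a)|L] − E[Y(a)|L, A≠a]`; consequently, for any regular weighting function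
`π`, `E[Y(a)] = E[(1−1{A=a})·Cov(1{A=a}Y, π(Z,L)|L)/Cov(1{A=a}, π(Z,L)|L) + 1{A=a}·Y]`. -/
theorem stmt17 {Ω : Type*} [mΩ : MeasurableSpace Ω] [StandardBorelSpace Ω]
    (μ : Measure Ω) [IsProbabilityMeasure μ]
    (A Y Z U L Ya : Ω → ℝ) (a : ℝ)
    (hA : Measurable A) (hY : Measurable Y) (hZ : Measurable Z) (hU : Measurable U)
    (hL : Measurable L) (hYa : Measurable Ya)
    (B : Ω → ℝ) (hB : B = fun ω => if A ω = a then (1 : ℝ) else 0)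
    -- consistency: `Y = Y(a)` on `{A = a}`
    (hcons : ∀ ω, A ω = a → Y ω = Ya ω)
    -- latent ignorability: `Y(a) ⊥ (A,Z) | (U,L)`
    (hLI : CondIndepFun (mV U ⊔ mV L)
      (sup_le (measurable_iff_comap_le.mp hU) (measurable_iff_comap_le.mp hL))
      Ya (fun ω => (A ω, Z ω)) μ)
    -- IV independence: `Z ⊥ U | L`
    (hZU : CondIndepFun (mV L) (measurable_iff_comap_le.mp hL) Z U μ)
    -- multiplicative IV: `P(A ≠ a | Z,U,L) = b(U,L)·c(Z,L)`, `c` nonconstant in `Z`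
    (b c : ℝ → ℝ → ℝ)
    (hb : Measurable fun p : ℝ × ℝ => b p.1 p.2)
    (hc : Measurable fun p : ℝ × ℝ => c p.1 p.2)
    (hMIV : μ[fun ω => 1 - B ω | mV Z ⊔ mV U ⊔ mV L]
      =ᵐ[μ] fun ω => b (U ω) (L ω) * c (Z ω) (L ω))
    (hrel : ∀ l : ℝ, ∃ z₁ z₂ : ℝ, c z₁ l ≠ c z₂ l)
    -- NPIV solution
    (f0 : ℝ → ℝ → ℝ) (hf0 : Measurable fun p : ℝ × ℝ => f0 p.1 p.2)
    (hintf0 : Integrable (fun ω => f0 (B ω) (L ω)) μ)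
    (hsol : μ[fun ω => B ω * Y ω | mV Z ⊔ mV L]
      =ᵐ[μ] μ[fun ω => f0 (B ω) (L ω) | mV Z ⊔ mV L])
    -- regular weighting function
    (π : ℝ → ℝ → ℝ) (hπ : Measurable fun p : ℝ × ℝ => π p.1 p.2)
    (Cπ : ℝ) (hπbd : ∀ z l, |π z l| ≤ Cπ)
    (hRWF : ∃ ε : ℝ, 0 < ε ∧ ∀ᵐ ω ∂μ,
      ε ≤ |condCov μ (mV L) B (fun ω' => π (Z ω') (L ω')) ω|)
    -- `P(A ≠ a | L) ≠ 0` a.s., so that `E[Y(a) | L, A ≠ a]` is well defined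
    (hden : ∀ᵐ ω ∂μ, (μ[fun ω' => 1 - B ω' | mV L]) ω ≠ 0)
    -- integrability
    (hintYa : Integrable Ya μ)
    (hintBY : Integrable (fun ω => B ω * Y ω) μ)
    (hintest : Integrable (fun ω =>
      (1 - B ω) *
        (condCov μ (mV L) (fun ω' => B ω' * Y ω') (fun ω' => π (Z ω') (L ω')) ω /
          condCov μ (mV L) B (fun ω' => π (Z ω') (L ω')) ω) + B ω * Y ω) μ) :
    ((fun ω => f0 1 (L ω)) =ᵐ[μ] μ[Ya | mV L])
    ∧ ((fun ω => f0 0 (L ω))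
        =ᵐ[μ] fun ω =>
          (μ[Ya | mV L]) ω -
            (μ[fun ω' => (1 - B ω') * Ya ω' | mV L]) ω /
              (μ[fun ω' => 1 - B ω' | mV L]) ω)
    ∧ (∫ ω, Ya ω ∂μ
        = ∫ ω,
            (1 - B ω) *
              (condCov μ (mV L) (fun ω' => B ω' * Y ω')
                  (fun ω' => π (Z ω') (L ω')) ω /
                condCov μ (mV L) B (fun ω' => π (Z ω') (L ω')) ω) + B ω * Y ω ∂μ) := by
  have hL0 : mV L ≤ mΩ := measurable_iff_comap_le.mp hL
  have hU0 : mV U ≤ mΩ := measurable_iff_comap_le.mp hU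
  have hZ0 : mV Z ≤ mΩ := measurable_iff_comap_le.mp hZ
  have hAZ : Measurable (fun ω => (A ω, Z ω)) := hA.prodMk hZ
  have hAZ0 : mV (fun ω => (A ω, Z ω)) ≤ mΩ := measurable_iff_comap_le.mp hAZ
  have hUL0 : mV U ⊔ mV L ≤ mΩ := sup_le hU0 hL0
  have hZL0 : mV Z ⊔ mV L ≤ mΩ := sup_le hZ0 hL0
  have hZUL0 : mV Z ⊔ mV U ⊔ mV L ≤ mΩ := sup_le (sup_le hZ0 hU0) hL0
  have hF0 : mV (fun ω => (A ω, Z ω)) ⊔ (mV U ⊔ mV L) ≤ mΩ := sup_le hAZ0 hUL0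
  have hZm : Measurable[mV Z] Z := comap_measurable Z
  have hUm : Measurable[mV U] U := comap_measurable U
  have hLm : Measurable[mV L] L := comap_measurable L
  have hAZm : Measurable[mV (fun ω => (A ω, Z ω))] (fun ω => (A ω, Z ω)) :=
    comap_measurable (fun ω => (A ω, Z ω))
  have hBfun : Measurable (fun x : ℝ => if x = a then (1 : ℝ) else 0) :=
    Measurable.ite (measurableSet_singleton a) measurable_const measurable_const
  have hBm : Measurable B := by rw [hB]; exact hBfun.comp hA
  have hB01 : ∀ ω, B ω = 0 ∨ B ω = 1 := by
    intro ω; rw [hB]; dsimp only; split_ifs <;> simp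
  have hBb : ∀ ω, |B ω| ≤ 1 := fun ω => by rcases hB01 ω with h | h <;> simp [h]
  have hWb : ∀ ω, |1 - B ω| ≤ 1 := fun ω => by rcases hB01 ω with h | h <;> simp [h]
  have hWm : Measurable (fun ω => 1 - B ω) := measurable_const.sub hBm
  have hWi : Integrable (fun ω => 1 - B ω) μ :=
    Integrable.of_bound hWm.aestronglyMeasurable 1 (ae_of_all _ hWb)
  have hVi : Integrable (fun ω => (1 - B ω) * Ya ω) μ :=
    aux_bmul hWm.aestronglyMeasurable (ae_of_all _ hWb) hintYa
  have hBYY : ∀ ω, B ω * Y ω = B ω * Ya ω := by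
    intro ω
    by_cases h : A ω = a
    · rw [hcons ω h]
    · simp [hB, h]
  -- conditional independence consequences
  have hciU : ∀ F : Ω → ℝ, StronglyMeasurable[mV U ⊔ mV L] F → Integrable F μ →
      μ[F | mV Z ⊔ mV L] =ᵐ[μ] μ[F | mV L] := fun F hF hFi =>
    aux_ci hU hZ hL hL0 rfl hZU hF hFi
  have hciZ : ∀ F : Ω → ℝ, StronglyMeasurable[mV Z ⊔ mV L] F → Integrable F μ →
      μ[F | mV U ⊔ mV L] =ᵐ[μ] μ[F | mV L] := fun F hF hFi =>
    aux_ci hZ hU hL hL0 rfl hZU.symm hF hFi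
  have hYam : StronglyMeasurable[mV Ya ⊔ (mV U ⊔ mV L)] Ya :=
    (Measurable.stronglyMeasurable (comap_measurable Ya)).mono
      (le_sup_left : mV Ya ≤ mV Ya ⊔ (mV U ⊔ mV L))
  have hYaF : μ[Ya | mV (fun ω => (A ω, Z ω)) ⊔ (mV U ⊔ mV L)] =ᵐ[μ] μ[Ya | mV U ⊔ mV L] :=
    aux_ci (k := fun ω => (U ω, L ω)) hYa hAZ (hU.prodMk hL) hUL0
      (MeasurableSpace.comap_prodMk U L).symm hLI.symm hYam hintYa
  have hZF : mV Z ≤ mV (fun ω => (A ω, Z ω)) := by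
    have : Measurable[mV (fun ω => (A ω, Z ω))] Z := measurable_snd.comp hAZm
    exact measurable_iff_comap_le.mp this
  have hZULF : mV Z ⊔ mV U ⊔ mV L ≤ mV (fun ω => (A ω, Z ω)) ⊔ (mV U ⊔ mV L) := by
    rw [sup_assoc]; exact sup_le_sup_right hZF _
  have hULZ : mV U ⊔ mV L ≤ mV Z ⊔ mV U ⊔ mV L := by
    rw [sup_assoc]; exact le_sup_right
  have hZLZ : mV Z ⊔ mV L ≤ mV Z ⊔ mV U ⊔ mV L := sup_le_sup_right le_sup_left _
  have hWF : StronglyMeasurable[mV (fun ω => (A ω, Z ω)) ⊔ (mV U ⊔ mV L)] (fun ω => 1 - B ω) := by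
    have h1 : Measurable[mV (fun ω => (A ω, Z ω))] (fun ω => 1 - B ω) := by
      have h2 : Measurable (fun p : ℝ × ℝ => 1 - if p.1 = a then (1 : ℝ) else 0) :=
        measurable_const.sub (hBfun.comp measurable_fst)
      have h3 := h2.comp hAZm
      rw [hB]; exact h3
    exact h1.stronglyMeasurable.mono
      (le_sup_left : mV (fun ω => (A ω, Z ω)) ≤ mV (fun ω => (A ω, Z ω)) ⊔ (mV U ⊔ mV L))
  have hgm : StronglyMeasurable[mV U ⊔ mV L] (μ[Ya | mV U ⊔ mV L]) := stronglyMeasurable_condExp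
  have hgi : Integrable (μ[Ya | mV U ⊔ mV L]) μ := integrable_condExp
  have hWg : Integrable (fun ω => (μ[Ya | mV U ⊔ mV L]) ω * (1 - B ω)) μ := by
    have := aux_bmul hWm.aestronglyMeasurable (ae_of_all μ hWb) hgi
    simpa only [mul_comm] using this
  have hMV : μ[fun ω => (1 - B ω) * Ya ω | mV Z ⊔ mV U ⊔ mV L] =ᵐ[μ]
      fun ω => b (U ω) (L ω) * c (Z ω) (L ω) * (μ[Ya | mV U ⊔ mV L]) ω := by
    have e1 : μ[fun ω => (1 - B ω) * Ya ω | mV (fun ω => (A ω, Z ω)) ⊔ (mV U ⊔ mV L)] =ᵐ[μ]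
        fun ω => (μ[Ya | mV U ⊔ mV L]) ω * (1 - B ω) := by
      filter_upwards [aux_pull hWF hVi hintYa, hYaF] with ω h1 h2
      rw [h1, h2, mul_comm]
    filter_upwards [condExp_condExp_of_le (μ := μ) (f := fun ω => (1 - B ω) * Ya ω) hZULF hF0,
      condExp_congr_ae (m := mV Z ⊔ mV U ⊔ mV L) e1,
      aux_pull (hgm.mono hULZ) hWg hWi, hMIV] with ω h1 h2 h3 h4
    rw [← h1, h2, h3, h4, mul_comm]
  have hYaZ : μ[Ya | mV Z ⊔ mV L] =ᵐ[μ] μ[Ya | mV L] := by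
    have hZLF := hZLZ.trans hZULF
    have t1 := condExp_condExp_of_le (μ := μ) (f := Ya) hZLF hF0
    have t2 := condExp_congr_ae (m := mV Z ⊔ mV L) hYaF
    have t3 := hciU _ hgm hgi
    have t4 := condExp_condExp_of_le (μ := μ) (f := Ya)
      (le_sup_right : mV L ≤ mV U ⊔ mV L) hUL0
    exact t1.symm.trans (t2.trans (t3.trans t4))
  have hbm : StronglyMeasurable[mV U ⊔ mV L] (fun ω => b (U ω) (L ω)) := by
    have h1 : Measurable[mV U ⊔ mV L] (fun ω => (U ω, L ω)) :=
      (hUm.mono le_sup_left le_rfl).prodMk (hLm.mono le_sup_right le_rfl)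
    exact (hb.comp h1).stronglyMeasurable
  have hZLm : Measurable[mV Z ⊔ mV L] (fun ω => (Z ω, L ω)) :=
    (hZm.mono le_sup_left le_rfl).prodMk (hLm.mono le_sup_right le_rfl)
  have hcm : StronglyMeasurable[mV Z ⊔ mV L] (fun ω => c (Z ω) (L ω)) :=
    (hc.comp hZLm).stronglyMeasurable
  have hPm : StronglyMeasurable[mV Z ⊔ mV L] (fun ω => π (Z ω) (L ω)) :=
    (hπ.comp hZLm).stronglyMeasurable
  have hkey := aux_key hZUL0 (le_sup_right : mV L ≤ mV Z ⊔ mV L)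
    (le_sup_right : mV L ≤ mV U ⊔ mV L) hZLZ hULZ hciZ hciU hbm hcm hgm hgi hWi hWb hVi
    hMIV hMV hden
  have hfm : ∀ x : ℝ, StronglyMeasurable[mV L] (fun ω => f0 x (L ω)) := by
    intro x
    have h1 : Measurable (fun l : ℝ => f0 x l) := hf0.comp (measurable_const.prodMk measurable_id)
    exact (h1.comp hLm).stronglyMeasurable
  have hi1 : Integrable (fun ω => f0 1 (L ω) * B ω) μ := by
    refine (aux_bmul hBm.aestronglyMeasurable (ae_of_all μ hBb) hintf0).congr
      (ae_of_all _ fun ω => ?_)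
    dsimp only
    rcases hB01 ω with h | h <;> simp [h]
  have hi0 : Integrable (fun ω => f0 0 (L ω) * (1 - B ω)) μ := by
    refine (aux_bmul hWm.aestronglyMeasurable (ae_of_all μ hWb) hintf0).congr
      (ae_of_all _ fun ω => ?_)
    dsimp only
    rcases hB01 ω with h | h <;> simp [h]
  have hfe : (fun ω => f0 (B ω) (L ω)) =
      fun ω => f0 1 (L ω) * B ω + f0 0 (L ω) * (1 - B ω) := by
    ext ω
    rcases hB01 ω with h | h <;> simp [h]
  rw [hfe] at hsol
  have hcov : ∀ᵐ ω ∂μ, condCov μ (mV L) B (fun ω' => π (Z ω') (L ω')) ω ≠ 0 := by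
    obtain ⟨ε, hε, h⟩ := hRWF
    filter_upwards [h] with ω h1 h2
    rw [h2, abs_zero] at h1
    linarith
  exact aux_final (le_sup_right : mV L ≤ mV Z ⊔ mV L) hZL0 hBm hB01 hBYY hintYa (hfm 1) (hfm 0)
    hPm (fun ω => hπbd _ _) hi1 hi0 hsol hYaZ hkey hden hcov hintest
end

section
/- (One-step longitudinal identification) Let H be a history σ-algebra, A_t ∈ {0,1} a treatment indicator, Z_t an instrument, and V an integrable 'future value' random variable with E[V | everything at time t, potential-outcome version] well-defined. Assume: (i) (Z_t, A_t) ⊥ V* | (H, Ū) where V* is the relevant potential value; (ii) Z_t ⊥ Ū | H; (iii) P(A_t = 1 | Z_t, Ū, H) = b(Ū,H) + c(Z_t,H) with c nonconstant in Z_t given H; (iv) π(Z_t,H) bounded with Cov(A_t, π(Z_t,H)|H) ≠ 0. If E[V | H_{t+1}] = E[V* | H_{t+1}] on {A_t = 1}, then Cov(A_t·V, π(Z_t,H) | H) / Cov(A_t, π(Z_t,H) | H) = E[V* | H]. -/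
open MeasureTheory ProbabilityTheory

namespace S18
set_option linter.unusedSectionVars false
open Filter

variable {Ω : Type*} {mΩ : MeasurableSpace Ω} {μ : Measure Ω} [IsProbabilityMeasure μ]

lemma gen_sup (m m2 : MeasurableSpace Ω) :
    m2 ⊔ m = MeasurableSpace.generateFrom
      {s | ∃ t h, MeasurableSet[m2] t ∧ MeasurableSet[m] h ∧ s = h ∩ t} := by
  apply le_antisymm
  · apply sup_le
    · intro t ht
      exact MeasurableSpace.measurableSet_generateFrom ⟨t, Set.univ, ht, MeasurableSet.univ, by simp⟩
    · intro h hh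
      exact MeasurableSpace.measurableSet_generateFrom ⟨Set.univ, h, MeasurableSet.univ, hh, by simp⟩
  · apply MeasurableSpace.generateFrom_le
    rintro s ⟨t, h, ht, hh, rfl⟩
    exact MeasurableSet.inter ((le_sup_right : m ≤ m2 ⊔ m) _ hh) ((le_sup_left : m2 ≤ m2 ⊔ m) _ ht)

lemma pi_sup (m m2 : MeasurableSpace Ω) :
    IsPiSystem {s : Set Ω | ∃ t h, MeasurableSet[m2] t ∧ MeasurableSet[m] h ∧ s = h ∩ t} := by
  rintro _ ⟨t, h, ht, hh, rfl⟩ _ ⟨t', h', ht', hh', rfl⟩ _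
  exact ⟨t ∩ t', h ∩ h', ht.inter ht', hh.inter hh', by
    ext x; simp only [Set.mem_inter_iff]; tauto⟩

lemma mul_ind (f : Ω → ℝ) (t : Set Ω) : f * t.indicator (fun _ => (1 : ℝ)) = t.indicator f := by
  funext x
  by_cases hx : x ∈ t <;> simp [hx]

/-- test lemma -/
lemma testL {m m2 : MeasurableSpace Ω} (hm : m ≤ mΩ) (hm2 : m2 ≤ mΩ) {f g : Ω → ℝ}
    (hf : Integrable f μ) (hg : Integrable g μ) (hgm : StronglyMeasurable[m] g)
    (h : ∀ t, MeasurableSet[m2] t → μ[f * t.indicator (fun _ => (1 : ℝ)) | m] =ᵐ[μ]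
      μ[g * t.indicator (fun _ => (1 : ℝ)) | m]) :
    μ[f | m2 ⊔ m] =ᵐ[μ] g := by
  have hsup : m2 ⊔ m ≤ mΩ := sup_le hm2 hm
  symm
  apply ae_eq_condExp_of_forall_setIntegral_eq hsup hf (fun s _ _ => hg.integrableOn)
    _ (hgm.mono le_sup_right).aestronglyMeasurable
  intro s hs _
  have key : ∀ s, MeasurableSet[m2 ⊔ m] s → ∫ x in s, g x ∂μ = ∫ x in s, f x ∂μ := by
    have basic : ∀ t h, MeasurableSet[m2] t → MeasurableSet[m] h →
        ∫ x in h ∩ t, g x ∂μ = ∫ x in h ∩ t, f x ∂μ := by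
      intro t r ht hr
      have := h t ht
      rw [mul_ind, mul_ind] at this
      rw [← setIntegral_indicator (hm2 _ ht), ← setIntegral_indicator (hm2 _ ht),
        ← setIntegral_condExp hm (hg.indicator (hm2 _ ht)) hr,
        ← setIntegral_condExp hm (hf.indicator (hm2 _ ht)) hr]
      exact (integral_congr_ae (ae_restrict_of_ae this)).symm
    have huniv : ∫ x, g x ∂μ = ∫ x, f x ∂μ := by
      have := basic Set.univ Set.univ MeasurableSet.univ MeasurableSet.univ
      simpa using this
    intro s hs
    induction s, hs using MeasurableSpace.induction_on_inter (gen_sup m m2) (pi_sup m m2) with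
    | empty => simp
    | basic t ht =>
      obtain ⟨t, r, ht, hr, rfl⟩ := ht
      exact basic t r ht hr
    | compl t ht ih =>
      have h1 := integral_add_compl (hsup _ ht) hf
      have h2 := integral_add_compl (hsup _ ht) hg
      linarith
    | iUnion F hd hF ih =>
      rw [integral_iUnion (fun i => hsup _ (hF i)) hd hg.integrableOn,
        integral_iUnion (fun i => hsup _ (hF i)) hd hf.integrableOn]
      exact tsum_congr ih
  exact key s hs

lemma poL {m : MeasurableSpace Ω} (hm : m ≤ mΩ) {f g : Ω → ℝ} (hf : StronglyMeasurable[m] f)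
    (hg : Integrable g μ) (C : ℝ) (hb : ∀ᵐ ω ∂μ, |f ω| ≤ C) :
    μ[f * g | m] =ᵐ[μ] f * μ[g | m] :=
  condExp_stronglyMeasurable_mul_of_bound hm hf hg C hb

lemma poR {m : MeasurableSpace Ω} (hm : m ≤ mΩ) {f g : Ω → ℝ} (hf : StronglyMeasurable[m] f)
    (hg : Integrable g μ) (C : ℝ) (hb : ∀ᵐ ω ∂μ, |f ω| ≤ C) :
    μ[g * f | m] =ᵐ[μ] μ[g | m] * f := by
  rw [mul_comm, mul_comm (μ[g | m])]
  exact poL hm hf hg C hb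

lemma intb {f g : Ω → ℝ} (hf : AEStronglyMeasurable f μ)
    (hg : Integrable g μ) (C : ℝ) (hb : ∀ᵐ ω ∂μ, |f ω| ≤ C) : Integrable (f * g) μ :=
  hg.bdd_mul hf hb

lemma ind_bd (t : Set Ω) : ∀ᵐ ω ∂μ, |t.indicator (fun _ => (1 : ℝ)) ω| ≤ 1 := by
  refine ae_of_all _ fun x => ?_
  by_cases hx : x ∈ t <;> simp [hx]

lemma ce_bd (m : MeasurableSpace Ω) {f : Ω → ℝ} {C : ℝ} (hb : ∀ᵐ ω ∂μ, |f ω| ≤ C) :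
    ∀ᵐ ω ∂μ, |(μ[f | m]) ω| ≤ C := ae_bdd_abs_condExp_of_ae_bdd_abs hb

lemma proj1 {m m1 m2 : MeasurableSpace Ω} (hm : m ≤ mΩ) (hm1 : m1 ≤ mΩ) (hm2 : m2 ≤ mΩ)
    (hP : ∀ s t, MeasurableSet[m1] s → MeasurableSet[m2] t →
      μ[(s ∩ t).indicator (fun _ => (1 : ℝ)) | m] =ᵐ[μ]
      μ[s.indicator (fun _ => (1 : ℝ)) | m] * μ[t.indicator (fun _ => (1 : ℝ)) | m])
    {t : Set Ω} (ht : MeasurableSet[m2] t) :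
    μ[t.indicator (fun _ => (1 : ℝ)) | m1 ⊔ m] =ᵐ[μ] μ[t.indicator (fun _ => (1 : ℝ)) | m] := by
  refine testL hm hm1 ((integrable_const _).indicator (hm2 _ ht)) integrable_condExp
    stronglyMeasurable_condExp ?_
  intro s hs
  rw [mul_ind, Set.indicator_indicator]
  refine (hP s t hs ht).trans ?_
  rw [mul_comm]
  exact (poL hm stronglyMeasurable_condExp ((integrable_const _).indicator (hm1 _ hs)) 1
    (ce_bd m (ind_bd t))).symm

lemma proj2 {m m1 m2 : MeasurableSpace Ω} (hm : m ≤ mΩ) (hm1 : m1 ≤ mΩ) (hm2 : m2 ≤ mΩ)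
    (hP : ∀ s t, MeasurableSet[m1] s → MeasurableSet[m2] t →
      μ[(s ∩ t).indicator (fun _ => (1 : ℝ)) | m] =ᵐ[μ]
      μ[s.indicator (fun _ => (1 : ℝ)) | m] * μ[t.indicator (fun _ => (1 : ℝ)) | m])
    {f : Ω → ℝ} (hf : Integrable f μ) (hfm : StronglyMeasurable[m1 ⊔ m] f) :
    μ[f | m2 ⊔ m] =ᵐ[μ] μ[f | m] := by
  refine testL hm hm2 hf integrable_condExp stronglyMeasurable_condExp ?_
  intro t ht
  have hsup : m1 ⊔ m ≤ mΩ := sup_le hm1 hm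
  have hti : Integrable (t.indicator (fun _ => (1 : ℝ))) μ :=
    (integrable_const _).indicator (hm2 _ ht)
  have hft : ∀ g : Ω → ℝ, Integrable g μ → Integrable (g * t.indicator (fun _ => (1 : ℝ))) μ := by
    intro g hg
    rw [mul_comm]
    exact intb hti.aestronglyMeasurable hg 1 (ind_bd t)
  have e1 : μ[f * t.indicator (fun _ => (1 : ℝ)) | m1 ⊔ m] =ᵐ[μ]
      f * μ[t.indicator (fun _ => (1 : ℝ)) | m] :=
    (condExp_mul_of_stronglyMeasurable_left hfm (hft f hf) hti).trans
      ((EventuallyEq.refl _ f).mul (proj1 hm hm1 hm2 hP ht))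
  calc μ[f * t.indicator (fun _ => (1 : ℝ)) | m]
      =ᵐ[μ] μ[μ[f * t.indicator (fun _ => (1 : ℝ)) | m1 ⊔ m] | m] :=
        (condExp_condExp_of_le le_sup_right hsup).symm
    _ =ᵐ[μ] μ[f * μ[t.indicator (fun _ => (1 : ℝ)) | m] | m] := condExp_congr_ae e1
    _ =ᵐ[μ] μ[f | m] * μ[t.indicator (fun _ => (1 : ℝ)) | m] :=
        poR hm stronglyMeasurable_condExp hf 1 (ce_bd m (ind_bd t))
    _ =ᵐ[μ] μ[μ[f | m] * t.indicator (fun _ => (1 : ℝ)) | m] :=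
        (condExp_mul_of_stronglyMeasurable_left stronglyMeasurable_condExp
          (hft _ integrable_condExp) hti).symm

lemma prodL {H n1 n2 : MeasurableSpace Ω} (hn1 : n1 ≤ mΩ) (hn2 : n2 ≤ mΩ) (h2 : H ≤ n2)
    (hK : ∀ f : Ω → ℝ, Integrable f μ → StronglyMeasurable[n1] f → μ[f | n2] =ᵐ[μ] μ[f | H])
    {f g : Ω → ℝ} (hf : StronglyMeasurable[n1] f) (C : ℝ) (hb : ∀ᵐ ω ∂μ, |f ω| ≤ C)
    (hg : Integrable g μ) (hgm : StronglyMeasurable[n2] g) :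
    μ[f * g | H] =ᵐ[μ] μ[f | H] * μ[g | H] := by
  have hfi : Integrable f μ := by
    have := intb (hf.mono hn1).aestronglyMeasurable (integrable_const (1 : ℝ)) C hb
    refine this.congr (ae_of_all _ fun x => by simp)
  have hfg := intb (hf.mono hn1).aestronglyMeasurable hg C hb
  calc μ[f * g | H] =ᵐ[μ] μ[μ[f * g | n2] | H] := (condExp_condExp_of_le h2 hn2).symm
    _ =ᵐ[μ] μ[μ[f | n2] * g | H] :=
      condExp_congr_ae (condExp_mul_of_stronglyMeasurable_right hgm hfg hfi)
    _ =ᵐ[μ] μ[μ[f | H] * g | H] := condExp_congr_ae ((hK f hfi hf).mul (EventuallyEq.refl _ g))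
    _ =ᵐ[μ] μ[f | H] * μ[g | H] := poL (h2.trans hn2) stronglyMeasurable_condExp hg C (ce_bd H hb)

/-- localisation -/
lemma locL {H n1 n2 : MeasurableSpace Ω} (hn1 : n1 ≤ mΩ) (hn2 : n2 ≤ mΩ) (h2 : H ≤ n2)
    (hK : ∀ f : Ω → ℝ, Integrable f μ → StronglyMeasurable[n1] f → μ[f | n2] =ᵐ[μ] μ[f | H])
    {b c : Ω → ℝ} (hbm : Measurable[n2] b) (hcm : Measurable[n1] c)
    (hbc : ∀ᵐ ω ∂μ, |b ω + c ω| ≤ 1) :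
    ∃ G : ℕ → Set Ω, (∀ n, MeasurableSet[H] (G n)) ∧ (∀ᵐ ω ∂μ, ∃ n, ω ∈ G n) ∧
      ∀ n, ∃ C : ℝ, ∀ᵐ ω ∂μ, ω ∈ G n → |b ω| ≤ C ∧ |c ω| ≤ C := by
  have hHle : H ≤ mΩ := h2.trans hn2
  let S : ℕ → Set Ω := fun n => {ω | |c ω| ≤ n}
  have hS1 : ∀ n, MeasurableSet[n1] (S n) := fun n =>
    measurableSet_le (measurable_abs.comp hcm) measurable_const
  have hS : ∀ n, MeasurableSet[mΩ] (S n) := fun n => hn1 _ (hS1 n)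
  let q : ℕ → Ω → ℝ := fun n => μ[(S n).indicator (fun _ => (1 : ℝ)) | H]
  have hSi : ∀ n, Integrable ((S n).indicator (fun _ => (1 : ℝ))) μ := fun n =>
    (integrable_const _).indicator (hS n)
  have hqm : ∀ n, Measurable[H] (q n) := fun n => stronglyMeasurable_condExp.measurable
  refine ⟨fun n => {ω | 1 / 2 < q n ω}, fun n => ?_, ?_, fun n => ?_⟩
  · exact measurableSet_lt measurable_const (hqm n)
  · let B : Set Ω := {ω | ∀ n, q n ω ≤ 1 / 2}
    have hB : MeasurableSet[H] B := by
      have : B = ⋂ n, {ω | q n ω ≤ 1 / 2} := by ext; simp [B]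
      rw [this]
      exact MeasurableSet.iInter fun n =>
        measurableSet_le (hqm n) measurable_const
    have hB' : MeasurableSet[mΩ] B := hHle _ hB
    have h1 : ∀ n, μ.real (B ∩ S n) ≤ μ.real B / 2 := by
      intro n
      have e := setIntegral_condExp hHle (hSi n) hB
      rw [setIntegral_indicator (hS n)] at e
      have e2 : ∫ x in B, q n x ∂μ ≤ ∫ x in B, (1 / 2 : ℝ) ∂μ :=
        setIntegral_mono_on integrable_condExp.integrableOn (integrable_const _).integrableOn hB'
          (fun x hx => hx n)
      simp only [setIntegral_const, smul_eq_mul, mul_one] at e e2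
      have : ∫ x in B, q n x ∂μ = μ.real (B ∩ S n) := e
      linarith
    have h2 : Tendsto (fun n => μ.real (B ∩ S n)) atTop (nhds (μ.real B)) := by
      have hmono : Monotone (fun n => B ∩ S n) := by
        intro i j hij x hx
        refine ⟨hx.1, le_trans (show |c x| ≤ i from hx.2) ?_⟩
        exact_mod_cast hij
      have hU : (⋃ n, B ∩ S n) = B := by
        ext x
        simp only [Set.mem_iUnion, Set.mem_inter_iff]
        refine ⟨fun ⟨_, h, _⟩ => h, fun h => ?_⟩
        obtain ⟨n, hn⟩ := exists_nat_ge |c x|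
        exact ⟨n, h, hn⟩
      have := tendsto_measure_iUnion_atTop (μ := μ) hmono
      rw [hU] at this
      exact (ENNReal.tendsto_toReal (measure_ne_top μ B)).comp this
    have h3 : μ.real B ≤ μ.real B / 2 := le_of_tendsto' h2 h1
    have h4 : μ.real B = 0 := by
      have : 0 ≤ μ.real B := measureReal_nonneg
      linarith
    have h5 : μ B = 0 := by
      rwa [measureReal_eq_zero_iff] at h4
    have h6 : ∀ᵐ ω ∂μ, ω ∉ B := measure_eq_zero_iff_ae_notMem.mp h5
    filter_upwards [h6] with ω hω
    simpa [B] using hω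
  · refine ⟨2 * (n + 1) + 1, ?_⟩
    have hbb : ∀ᵐ ω ∂μ, |(b * (S n).indicator (fun _ => (1 : ℝ))) ω| ≤ (n : ℝ) + 1 := by
      filter_upwards [hbc] with ω hω
      rw [mul_ind]
      by_cases hx : ω ∈ S n
      · have hx' : |c ω| ≤ n := hx
        rw [Set.indicator_of_mem hx]
        rw [abs_le] at *
        constructor <;> linarith [hx'.1, hx'.2, hω.1, hω.2]
      · rw [Set.indicator_of_notMem hx]
        simp; positivity
    have hbmes : AEStronglyMeasurable[mΩ] b μ := (hbm.mono hn2 le_rfl).aestronglyMeasurable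
    have hbi : Integrable (b * (S n).indicator (fun _ => (1 : ℝ))) μ := by
      have := intb (hbmes.mul (hSi n).aestronglyMeasurable) (integrable_const (1 : ℝ)) _ hbb
      exact this.congr (ae_of_all _ fun x => by simp)
    have e1 := condExp_mul_of_stronglyMeasurable_left (m := n2)
      (Measurable.stronglyMeasurable hbm) hbi (hSi n)
    have e2 := hK _ (hSi n) ((@stronglyMeasurable_const _ _ n1 _ (1 : ℝ)).indicator (hS1 n))
    filter_upwards [hbc, e1, e2, ce_bd n2 hbb] with ω h1 h2 h3 h4 h5
    rw [h2, Pi.mul_apply, h3, abs_mul] at h4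
    have h5' : 1 / 2 < q n ω := h5
    have h6 : |b ω| * |q n ω| ≤ n + 1 := h4
    have h7 : q n ω ≤ |q n ω| := le_abs_self _
    have h8 : |b ω| ≤ 2 * (n + 1) := by nlinarith [abs_nonneg (b ω)]
    refine ⟨by linarith, ?_⟩
    rw [abs_le] at *
    constructor <;> linarith [h8.1, h8.2, h1.1, h1.2]

lemma coreL {H n1 n2 : MeasurableSpace Ω} (hn1 : n1 ≤ mΩ) (hn2 : n2 ≤ mΩ) (h1 : H ≤ n1)
    (h2 : H ≤ n2)
    (hK : ∀ f : Ω → ℝ, Integrable f μ → StronglyMeasurable[n1] f → μ[f | n2] =ᵐ[μ] μ[f | H])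
    {b c W φ : Ω → ℝ} (hbm : Measurable[n2] b) (hcm : Measurable[n1] c)
    (hbc : ∀ᵐ ω ∂μ, |b ω + c ω| ≤ 1) (hW : Integrable W μ) (hWm : StronglyMeasurable[n2] W)
    (hφm : StronglyMeasurable[n1] φ) (D : ℝ) (hφ : ∀ᵐ ω ∂μ, |φ ω| ≤ D)
    (hφ0 : μ[φ | H] =ᵐ[μ] 0) :
    μ[(b + c) * φ * W | H] =ᵐ[μ] μ[W | H] * μ[(b + c) * φ | H] := by
  have hHle : H ≤ mΩ := h2.trans hn2
  obtain ⟨G, hG, hGU, hGb⟩ := locL hn1 hn2 h2 hK hbm hcm hbc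
  have hbs : StronglyMeasurable[n2] b := Measurable.stronglyMeasurable hbm
  have hcs : StronglyMeasurable[n1] c := Measurable.stronglyMeasurable hcm
  have hφa : AEStronglyMeasurable[mΩ] φ μ := (hφm.mono hn1).aestronglyMeasurable
  have hφi : Integrable φ μ := by
    have := intb hφa (integrable_const (1 : ℝ)) D hφ
    exact this.congr (ae_of_all _ fun x => by simp)
  have hbca : AEStronglyMeasurable[mΩ] (b + c) μ :=
    ((hbs.mono hn2).add (hcs.mono hn1)).aestronglyMeasurable
  have hpi : Integrable ((b + c) * φ) μ := intb hbca hφi 1 hbc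
  have hpWi : Integrable ((b + c) * φ * W) μ := by
    rw [mul_assoc]
    exact intb hbca (intb hφa hW D hφ) 1 hbc
  have key : ∀ n, ∀ᵐ ω ∂μ, ω ∈ G n →
      (μ[(b + c) * φ * W | H]) ω = (μ[W | H]) ω * (μ[(b + c) * φ | H]) ω := by
    intro n
    obtain ⟨C, hC⟩ := hGb n
    have hb' : StronglyMeasurable[n2] ((G n).indicator b) := hbs.indicator (h2 _ (hG n))
    have hc' : StronglyMeasurable[n1] ((G n).indicator c) := hcs.indicator (h1 _ (hG n))
    have hbB : ∀ᵐ ω ∂μ, |(G n).indicator b ω| ≤ |C| := by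
      filter_upwards [hC] with ω h
      by_cases hx : ω ∈ G n
      · simpa [hx] using (h hx).1.trans (le_abs_self C)
      · simp [hx]
    have hcB : ∀ᵐ ω ∂μ, |(G n).indicator c ω| ≤ |C| := by
      filter_upwards [hC] with ω h
      by_cases hx : ω ∈ G n
      · simpa [hx] using (h hx).2.trans (le_abs_self C)
      · simp [hx]
    have hcφB : ∀ᵐ ω ∂μ, |((G n).indicator c * φ) ω| ≤ |C| * D := by
      filter_upwards [hcB, hφ] with ω h h'
      rw [Pi.mul_apply, abs_mul]
      exact mul_le_mul h h' (abs_nonneg _) (abs_nonneg _)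
    have hba := (hb'.mono hn2).aestronglyMeasurable (μ := μ)
    have hca := (hc'.mono hn1).aestronglyMeasurable (μ := μ)
    have hbi : Integrable ((G n).indicator b) μ := by
      have := intb hba (integrable_const (1 : ℝ)) _ hbB
      exact this.congr (ae_of_all _ fun x => by simp)
    have hbWi : Integrable ((G n).indicator b * W) μ := intb hba hW _ hbB
    -- products
    have p1 := prodL hn1 hn2 h2 hK hφm D hφ hbWi (hb'.mul hWm)
    have p2 := prodL hn1 hn2 h2 hK hφm D hφ hbi hb'
    have p3 := prodL hn1 hn2 h2 hK (hc'.mul hφm) _ hcφB hW hWm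
    have hi1 : Integrable (φ * ((G n).indicator b * W)) μ := intb hφa hbWi D hφ
    have hi2 : Integrable (φ * (G n).indicator b) μ := intb hφa hbi D hφ
    have hi4 : Integrable ((G n).indicator c * φ) μ := intb hca hφi _ hcB
    have hi3 : Integrable ((G n).indicator c * φ * W) μ := intb (hca.mul hφa) hW _ hcφB
    have q1 : (G n).indicator ((b + c) * φ * W) =
        φ * ((G n).indicator b * W) + (G n).indicator c * φ * W := by
      funext x
      by_cases hx : x ∈ G n <;> simp [hx]
      ring
    have q2 : (G n).indicator ((b + c) * φ) = φ * (G n).indicator b + (G n).indicator c * φ := by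
      funext x
      by_cases hx : x ∈ G n <;> simp [hx]
      ring
    have r1 := condExp_indicator (m := H) hpWi (hG n)
    have r2 := condExp_indicator (m := H) hpi (hG n)
    rw [q1] at r1
    rw [q2] at r2
    filter_upwards [p1, p2, p3, r1, r2, condExp_add hi1 hi3 H, condExp_add hi2 hi4 H, hφ0]
      with ω p1 p2 p3 r1 r2 s1 s2 h0 hω
    rw [Set.indicator_of_mem hω] at r1 r2
    simp only [Pi.mul_apply, Pi.add_apply, Pi.zero_apply] at p1 p2 p3 s1 s2 h0
    rw [← r1, ← r2, s1, s2, p1, p2, p3, h0]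
    ring
  filter_upwards [hGU, ae_all_iff.mpr key] with ω ⟨n, hn⟩ h
  exact h n hn

end S18

/-- (One-step longitudinal identification.) Conditional on a history
σ-algebra `H`, under latent ignorability, IV independence, the additive IV condition for
`A_t`, and a relevant weight `π(Z_t,H)`, if the future value `V` matches the potential
value `V*` at the next history `H'` on `{A_t = 1}`, then
`Cov(A_t·V, π | H) / Cov(A_t, π | H) = E[V* | H]` almost surely. -/
theorem stmt18 {Ω : Type*} [mΩ : MeasurableSpace Ω] [StandardBorelSpace Ω]
    (μ : Measure Ω) [IsProbabilityMeasure μ]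
    (At Zt Uv V Vstar : Ω → ℝ)
    (hAt : Measurable At) (hZt : Measurable Zt) (hUv : Measurable Uv)
    (hV : Measurable V) (hVstar : Measurable Vstar)
    (hAt01 : ∀ ω, At ω = 0 ∨ At ω = 1)
    -- history σ-algebras: `H` at time `t` and the next history `H'`
    (H H' : MeasurableSpace Ω) (hH : H ≤ mΩ) (hH' : H' ≤ mΩ)
    (hH'ge : H ⊔ mV Zt ⊔ mV At ≤ H')
    -- (i) latent ignorability: `(Z_t, A_t) ⊥ V* | (H, Ū)`
    (hLI : CondIndepFun (H ⊔ mV Uv) (sup_le hH (measurable_iff_comap_le.mp hUv))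
      (fun ω => (Zt ω, At ω)) Vstar μ)
    -- (ii) IV independence: `Z_t ⊥ Ū | H`
    (hZU : CondIndepFun H hH Zt Uv μ)
    -- (iii) additive IV: `P(A_t=1 | Z_t, Ū, H) = b(Ū,H) + c(Z_t,H)`, `c` nonconstant
    (b c : Ω → ℝ)
    (hbm : Measurable[mV Uv ⊔ H] b) (hcm : Measurable[mV Zt ⊔ H] c)
    (hadd : μ[At | mV Zt ⊔ mV Uv ⊔ H] =ᵐ[μ] fun ω => b ω + c ω)
    (hcnc : ∀ᵐ ω ∂μ, @condCov Ω mΩ μ H c c ω ≠ 0)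
    -- (iv) relevant bounded weight `π(Z_t, H)`
    (π : Ω → ℝ) (hπm : Measurable[mV Zt ⊔ H] π)
    (Cπ : ℝ) (hπbd : ∀ ω, |π ω| ≤ Cπ)
    (hcov : ∀ᵐ ω ∂μ, @condCov Ω mΩ μ H At π ω ≠ 0)
    -- the value matches the potential value one step ahead on `{A_t = 1}`
    (hfut : ∀ᵐ ω ∂μ, At ω = 1 → (μ[V | H']) ω = (μ[Vstar | H']) ω)
    -- integrability
    (hintV : Integrable V μ) (hintVstar : Integrable Vstar μ)
    (hintAV : Integrable (fun ω => At ω * V ω) μ) :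
    (fun ω =>
        @condCov Ω mΩ μ H (fun ω' => At ω' * V ω') π ω / @condCov Ω mΩ μ H At π ω)
      =ᵐ[μ] μ[Vstar | H] := by
  have hZle : mV Zt ≤ mΩ := measurable_iff_comap_le.mp hZt
  have hUle : mV Uv ≤ mΩ := measurable_iff_comap_le.mp hUv
  have hAle : mV At ≤ mΩ := measurable_iff_comap_le.mp hAt
  have hVle : mV Vstar ≤ mΩ := measurable_iff_comap_le.mp hVstar
  have hpair : Measurable[mΩ] (fun ω => (Zt ω, At ω)) := hZt.prodMk hAt
  have hPle : mV (fun ω => (Zt ω, At ω)) ≤ mΩ := measurable_iff_comap_le.mp hpair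
  have hUH : H ⊔ mV Uv ≤ mΩ := sup_le hH hUle
  have hn1 : mV Zt ⊔ H ≤ mΩ := sup_le hZle hH
  have hn2 : mV Uv ⊔ H ≤ mΩ := sup_le hUle hH
  have hK : ∀ f : Ω → ℝ, Integrable f μ → StronglyMeasurable[mV Zt ⊔ H] f →
      μ[f | mV Uv ⊔ H] =ᵐ[μ] μ[f | H] := fun f hf hfm =>
    S18.proj2 hH hZle hUle ((condIndepFun_iff H hH Zt Uv hZt hUv μ).mp hZU) hf hfm
  have hVs : StronglyMeasurable[mV Vstar ⊔ (H ⊔ mV Uv)] Vstar := by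
    have h0 : Measurable[mV Vstar] Vstar := comap_measurable Vstar
    exact (Measurable.stronglyMeasurable h0).mono le_sup_left
  have hN : μ[Vstar | mV (fun ω => (Zt ω, At ω)) ⊔ (H ⊔ mV Uv)] =ᵐ[μ]
      μ[Vstar | H ⊔ mV Uv] :=
    S18.proj2 hUH hVle hPle
      ((condIndepFun_iff (H ⊔ mV Uv) hUH Vstar _ hVstar hpair μ).mp hLI.symm) hintVstar hVs
  set N := mV (fun ω => (Zt ω, At ω)) ⊔ (H ⊔ mV Uv) with hNdef
  have hNle : N ≤ mΩ := sup_le hPle hUH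
  set W := μ[Vstar | H ⊔ mV Uv] with hWdef
  have hWi : Integrable W μ := integrable_condExp
  have hWm : StronglyMeasurable[H ⊔ mV Uv] W := stronglyMeasurable_condExp
  have hWm2 : StronglyMeasurable[mV Uv ⊔ H] W := hWm.mono (sup_comm _ _).le
  have hAbd : ∀ᵐ ω ∂μ, |At ω| ≤ 1 := ae_of_all _ fun ω => by
    rcases hAt01 ω with h | h <;> simp [h]
  have hbc : ∀ᵐ ω ∂μ, |b ω + c ω| ≤ 1 := by
    filter_upwards [hadd, S18.ce_bd (mV Zt ⊔ mV Uv ⊔ H) hAbd] with ω h1 h2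
    rwa [h1] at h2
  have hAa : AEStronglyMeasurable[mΩ] At μ := hAt.aestronglyMeasurable
  have hAi : Integrable At μ :=
    (S18.intb hAa (integrable_const (1 : ℝ)) 1 hAbd).congr (ae_of_all _ fun x => by simp)
  have hA_P : Measurable[mV (fun ω => (Zt ω, At ω))] At :=
    measurable_snd.comp (comap_measurable (fun ω => (Zt ω, At ω)))
  have hZ_P : Measurable[mV (fun ω => (Zt ω, At ω))] Zt :=
    measurable_fst.comp (comap_measurable (fun ω => (Zt ω, At ω)))
  have hA_N : StronglyMeasurable[N] At :=
    (Measurable.stronglyMeasurable hA_P).mono le_sup_left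
  have hn1N : mV Zt ⊔ H ≤ N :=
    sup_le ((measurable_iff_comap_le.mp hZ_P).trans le_sup_left)
      (le_sup_left.trans le_sup_right)
  have hHN : H ≤ N := le_sup_right.trans hn1N
  have hA_H' : StronglyMeasurable[H'] At := by
    have h0 : Measurable[mV At] At := comap_measurable At
    exact (Measurable.stronglyMeasurable h0).mono (le_sup_right.trans hH'ge)
  have hn1H' : mV Zt ⊔ H ≤ H' :=
    (sup_le (le_sup_right.trans le_sup_left) (le_sup_left.trans le_sup_left)).trans hH'ge
  have hHH' : H ≤ H' := le_sup_right.trans hn1H'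
  have hnle : mV Zt ⊔ mV Uv ⊔ H ≤ mΩ := sup_le (sup_le hZle hUle) hH
  have hn1n : mV Zt ⊔ H ≤ mV Zt ⊔ mV Uv ⊔ H :=
    sup_le (le_sup_left.trans le_sup_left) le_sup_right
  have hUHn : H ⊔ mV Uv ≤ mV Zt ⊔ mV Uv ⊔ H :=
    sup_le le_sup_right (le_sup_right.trans le_sup_left)
  have hHn : H ≤ mV Zt ⊔ mV Uv ⊔ H := le_sup_right
  have stepA : ∀ (φ : Ω → ℝ) (D : ℝ), StronglyMeasurable[mV Zt ⊔ H] φ →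
      (∀ᵐ ω ∂μ, |φ ω| ≤ D) → μ[At * φ | H] =ᵐ[μ] μ[(b + c) * φ | H] := by
    intro φ D hφm hφ
    have e1 := S18.poR hnle (hφm.mono hn1n) hAi D hφ
    refine (condExp_condExp_of_le hHn hnle).symm.trans (condExp_congr_ae ?_)
    filter_upwards [e1, hadd] with ω h1 h2
    rw [h1, Pi.mul_apply, h2]; rfl
  have stepV : ∀ (φ : Ω → ℝ) (D : ℝ), StronglyMeasurable[mV Zt ⊔ H] φ →
      (∀ᵐ ω ∂μ, |φ ω| ≤ D) → μ[At * φ * V | H] =ᵐ[μ] μ[(b + c) * φ * W | H] := by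
    intro φ D hφm hφ
    have hφa : AEStronglyMeasurable[mΩ] φ μ := (hφm.mono hn1).aestronglyMeasurable
    have hB : ∀ᵐ ω ∂μ, |(At * φ) ω| ≤ 1 * D := by
      filter_upwards [hAbd, hφ] with ω h1 h2
      rw [Pi.mul_apply, abs_mul]
      exact mul_le_mul h1 h2 (abs_nonneg _) zero_le_one
    have e1 := S18.poL hH' (hA_H'.mul (hφm.mono hn1H')) hintV _ hB
    have e2 := S18.poL hH' (hA_H'.mul (hφm.mono hn1H')) hintVstar _ hB
    have e3 := S18.poL hNle (hA_N.mul (hφm.mono hn1N)) hintVstar _ hB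
    have hAW : Integrable (φ * W * At) μ := by
      have := S18.intb (hAa.mul hφa) hWi _ hB
      refine this.congr (ae_of_all _ fun x => ?_)
      simp only [Pi.mul_apply]; ring
    have e4 := condExp_mul_of_stronglyMeasurable_left
      ((hφm.mono hn1n).mul (hWm.mono hUHn)) hAW hAi
    calc μ[At * φ * V | H] =ᵐ[μ] μ[μ[At * φ * V | H'] | H] :=
          (condExp_condExp_of_le hHH' hH').symm
      _ =ᵐ[μ] μ[μ[At * φ * Vstar | H'] | H] := by
          refine condExp_congr_ae ?_
          filter_upwards [e1, e2, hfut] with ω h1 h2 h3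
          rw [h1, h2]
          simp only [Pi.mul_apply]
          rcases hAt01 ω with h | h
          · simp [h]
          · rw [h3 h]
      _ =ᵐ[μ] μ[At * φ * Vstar | H] := condExp_condExp_of_le hHH' hH'
      _ =ᵐ[μ] μ[μ[At * φ * Vstar | N] | H] := (condExp_condExp_of_le hHN hNle).symm
      _ =ᵐ[μ] μ[φ * W * At | H] := by
          refine condExp_congr_ae ?_
          filter_upwards [e3, hN] with ω h1 h2
          rw [h1]
          simp only [Pi.mul_apply]
          rw [h2]; ring
      _ =ᵐ[μ] μ[μ[φ * W * At | mV Zt ⊔ mV Uv ⊔ H] | H] :=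
          (condExp_condExp_of_le hHn hnle).symm
      _ =ᵐ[μ] μ[(b + c) * φ * W | H] := by
          refine condExp_congr_ae ?_
          filter_upwards [e4, hadd] with ω h1 h2
          rw [h1]
          simp only [Pi.mul_apply, Pi.add_apply]
          rw [h2]; ring
  -- centred weight
  have hπs : StronglyMeasurable[mV Zt ⊔ H] π := Measurable.stronglyMeasurable hπm
  have hπb : ∀ᵐ ω ∂μ, |π ω| ≤ Cπ := ae_of_all _ hπbd
  have hπa : AEStronglyMeasurable[mΩ] π μ := (hπs.mono hn1).aestronglyMeasurable
  have hπi : Integrable π μ :=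
    (S18.intb hπa (integrable_const (1 : ℝ)) Cπ hπb).congr (ae_of_all _ fun x => by simp)
  set P := μ[π | H] with hPdef
  have hPi : Integrable P μ := integrable_condExp
  have hPm : StronglyMeasurable[H] P := stronglyMeasurable_condExp
  have hPb : ∀ᵐ ω ∂μ, |P ω| ≤ Cπ := S18.ce_bd H hπb
  have hφm : StronglyMeasurable[mV Zt ⊔ H] (π - P) := hπs.sub (hPm.mono le_sup_right)
  have hφb : ∀ᵐ ω ∂μ, |(π - P) ω| ≤ Cπ + Cπ := by
    filter_upwards [hPb] with ω h
    exact (abs_sub _ _).trans (add_le_add (hπbd ω) h)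
  have hφ0 : μ[π - P | H] =ᵐ[μ] 0 := by
    filter_upwards [condExp_sub hπi hPi H] with ω h
    rw [h, condExp_of_stronglyMeasurable hH hPm hPi]
    simp [hPdef]
  have cov : ∀ X : Ω → ℝ, Integrable X μ →
      @condCov Ω mΩ μ H X π =ᵐ[μ] μ[X * (π - P) | H] := by
    intro X hX
    have i1 : Integrable (X * π) μ := by
      rw [mul_comm]; exact S18.intb hπa hX _ hπb
    have i2 : Integrable (X * P) μ := by
      rw [mul_comm]; exact S18.intb hPi.aestronglyMeasurable hX _ hPb
    rw [mul_sub]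
    filter_upwards [condExp_sub i1 i2 H, S18.poR hH hPm hX _ hPb] with ω h1 h2
    rw [h1, Pi.sub_apply, h2]
    rfl
  have core := S18.coreL hn1 hn2 le_sup_right le_sup_right hK hbm hcm hbc hWi hWm2 hφm _ hφb hφ0
  have hWH : μ[W | H] =ᵐ[μ] μ[Vstar | H] := condExp_condExp_of_le le_sup_left hUH
  have eqf : (fun ω => At ω * V ω) * (π - P) = At * (π - P) * V := by
    funext x; simp only [Pi.mul_apply]; ring
  have covV := cov _ hintAV
  rw [eqf] at covV
  filter_upwards [covV, cov _ hAi, stepA _ _ hφm hφb, stepV _ _ hφm hφb, core, hWH, hcov]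
    with ω h1 h2 h3 h4 h5 h6 h7
  rw [div_eq_iff h7, h1, h2, h4, h5, h3, Pi.mul_apply, h6]
end
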